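/- Let 𝓛 ⊂ ℂ be a lattice, ω a half-period, η = ζ(ω), and assume the non-degeneracy conditions η + ωe_j ≠ 0 for j = 1,2,3 and the non-singularity condition u(k*) ≠ 0, where k* is a critical point of u (i.e., η + ω℘(k*) = 0). Then the closure Z̄_u ⊂ 𝓔 = ℂ/𝓛 of the zero set Z_u = {k ∈ 𝓔^× : u(k) = 0} of u(k) = Re[ηk − ωζ(k)] consists of two simple closed curves in 𝓔 representing the same non-trivial homology class. -/

import Mathlib

open Complex Set Filter

noncomputable section

/-- The period lattice with half-periods `w1`, `w3`, i.e. the set of all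
`2 m w1 + 2 n w3` with `m n : ℤ`. -/
def latticeSet (w1 w3 : ℂ) : Set ℂ := {z | ∃ m n : ℤ, z = 2 * m * w1 + 2 * n * w3}

/-- Weierstrass data for a lattice `𝓛` with basic half-periods `w1`, `w3`:
the functions `℘` (denoted `P`), `ζ` (denoted `Z`) and `σ` (denoted `S`),
characterized up to uniqueness by their standard analytic properties:
`℘` is `𝓛`-periodic, holomorphic off `𝓛`, with `℘(z) - 1/z² → 0` as `z → 0`;
`ζ` is odd with `ζ' = -℘`; `σ` is entire, non-vanishing off `𝓛`, with
`σ'/σ = ζ` and `σ(z)/z → 1` as `z → 0`. -/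
structure WeierstrassData where
  w1 : ℂ
  w3 : ℂ
  P : ℂ → ℂ
  Z : ℂ → ℂ
  S : ℂ → ℂ
  w1_ne : w1 ≠ 0
  indep : ∀ r : ℝ, w3 ≠ (r : ℂ) * w1
  P_diff : ∀ z ∉ latticeSet w1 w3, DifferentiableAt ℂ P z
  P_periodic : ∀ w ∈ latticeSet w1 w3, ∀ z, P (z + w) = P z
  P_pole : Tendsto (fun z => P z - 1 / z ^ 2) (nhdsWithin 0 {(0 : ℂ)}ᶜ) (nhds 0)
  Z_diff : ∀ z ∉ latticeSet w1 w3, DifferentiableAt ℂ Z z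
  Z_deriv : ∀ z ∉ latticeSet w1 w3, deriv Z z = -P z
  Z_odd : ∀ z, Z (-z) = -Z z
  S_diff : Differentiable ℂ S
  S_ne : ∀ z ∉ latticeSet w1 w3, S z ≠ 0
  S_deriv : ∀ z ∉ latticeSet w1 w3, deriv S z = Z z * S z
  S_norm : Tendsto (fun z => S z / z) (nhdsWithin 0 {(0 : ℂ)}ᶜ) (nhds 1)

namespace WeierstrassData

variable (W : WeierstrassData)

/-- The period lattice of `W`. -/
def lattice : Set ℂ := latticeSet W.w1 W.w3

/-- The third basic half-period `ω₂ = ω₁ + ω₃`. -/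
def w2 : ℂ := W.w1 + W.w3

/-- `e₁ = ℘(ω₁)`. -/
def e1 : ℂ := W.P W.w1
/-- `e₂ = ℘(ω₂)`. -/
def e2 : ℂ := W.P W.w2
/-- `e₃ = ℘(ω₃)`. -/
def e3 : ℂ := W.P W.w3

/-- The Rofe-Beketov spectrum of the complex Lamé operator
`L = -d²/dx² + m(m+1) ω² ℘(ωx + z₀)` in `L²(ℝ)`: the set of `λ ∈ ℂ` for which
the equation `Lψ = λψ` has a nonzero bounded solution on the whole real line. -/
def lameSpectrum (m : ℕ) (ω z0 : ℂ) : Set ℂ :=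
  {lam | ∃ φ : ℝ → ℂ, φ ≠ 0 ∧ ContDiff ℝ 2 φ ∧
    (∀ x : ℝ, -deriv (deriv φ) x + (m * (m + 1) : ℂ) * ω ^ 2 * W.P (ω * x + z0) * φ x
      = lam * φ x) ∧ ∃ C : ℝ, ∀ x : ℝ, ‖φ x‖ ≤ C}

/-- The function `u(k) = Re[η k - ω ζ(k)]`, where `η = ζ(ω)`. -/
def uFun (ω : ℂ) : ℂ → ℝ := fun k => (W.Z ω * k - ω * W.Z k).re

/-- The function `v(k) = Im[η k - ω ζ(k)]`, where `η = ζ(ω)`. -/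
def vFun (ω : ℂ) : ℂ → ℝ := fun k => (W.Z ω * k - ω * W.Z k).im

end WeierstrassData




/-- The period lattice of `W` as an additive subgroup of `ℂ`
(generated by `2ω₁` and `2ω₃`). -/
def latticeSubgroup (W : WeierstrassData) : AddSubgroup ℂ :=
  AddSubgroup.closure {2 * W.w1, 2 * W.w3}

namespace ZU
open Topology

/-- Abstract properties of the multivalued-on-torus function `F`. -/
structure Core (L : AddSubgroup ℂ) (F : ℂ → ℂ) : Prop where
  closed : IsClosed (L : Set ℂ)
  cont : ∀ k ∉ L, ContinuousAt F k
  per : ∀ l ∈ L, ∃ c : ℝ, ∀ k ∉ L, F (k + l) = F k + c * I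
  odd : ∀ k, F (-k) = -F k
  cpt : ∃ K : Set ℂ, IsCompact K ∧ ∀ k, ∃ l ∈ L, k + l ∈ K
  reg : ∀ k ∉ L, (F k).re = 0 → ∃ h : OpenPartialHomeomorph ℂ ℂ, k ∈ h.source ∧
    ∀ x ∈ h.source, x ∉ L ∧ h x = F x
  pole : ∃ h : OpenPartialHomeomorph ℂ ℂ, 0 ∈ h.source ∧ h 0 = 0 ∧
    ∀ x ∈ h.source, x ≠ 0 → x ∉ L ∧ F x ≠ 0 ∧ h x = (F x)⁻¹
  opn : ∀ k ∉ L, 𝓝 (F k) ≤ map F (𝓝 k)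

/-- Zero set together with the lattice. -/
def Zt (L : AddSubgroup ℂ) (F : ℂ → ℂ) : Set ℂ := {k | k ∈ L ∨ (F k).re = 0}
/-- Positive set. -/
def Ap (L : AddSubgroup ℂ) (F : ℂ → ℂ) : Set ℂ := {k | k ∉ L ∧ 0 < (F k).re}

variable {L : AddSubgroup ℂ} {F : ℂ → ℂ}

lemma Zt_neg : Zt L (fun k => -F k) = Zt L F := by
  ext k; simp [Zt]

/-- restrict an open partial homeomorphism so that its target is a ball -/
lemma restr_ball (h : OpenPartialHomeomorph ℂ ℂ) {z : ℂ} (hz : z ∈ h.source) :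
    ∃ ρ > 0, Metric.ball (h z) ρ ⊆ h.target := by
  exact Metric.isOpen_iff.1 h.open_target (h z) (h.map_source hz)

namespace Core

lemma neg (C : Core L F) : Core L (fun k => -F k) where
  closed := C.closed
  cont k hk := (C.cont k hk).neg
  per l hl := by
    obtain ⟨c, hc⟩ := C.per l hl
    refine ⟨-c, fun k hk => ?_⟩
    rw [hc k hk]; push_cast; ring
  odd k := by simp [C.odd k]
  cpt := C.cpt
  reg k hk h0 := by
    obtain ⟨h, h1, h2⟩ := C.reg k hk (by simpa using h0)
    refine ⟨h.trans (Homeomorph.neg ℂ).toOpenPartialHomeomorph, by simpa using h1, fun x hx => ?_⟩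
    have hx' : x ∈ h.source := by simpa using hx
    refine ⟨(h2 x hx').1, ?_⟩
    simp [(h2 x hx').2]
  pole := by
    obtain ⟨h, h1, h0, h2⟩ := C.pole
    refine ⟨h.trans (Homeomorph.neg ℂ).toOpenPartialHomeomorph, by simpa using h1,
      by simp [h0], fun x hx hx0 => ?_⟩
    have hx' : x ∈ h.source := by simpa using hx
    obtain ⟨a, b, c⟩ := h2 x hx' hx0
    exact ⟨a, by simpa using b, by simp [c]⟩
  opn k hk := by
    have h := C.opn k hk
    have h2 : map (fun x : ℂ => -x) (𝓝 (F k)) ≤ map (fun x : ℂ => -x) (map F (𝓝 k)) :=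
      Filter.map_mono h
    rw [Filter.map_map] at h2
    have h3 : map (fun x : ℂ => -x) (𝓝 (F k)) = 𝓝 (-F k) := (Homeomorph.neg ℂ).map_nhds_eq _
    rw [h3] at h2
    exact h2

lemma re_per (C : Core L F) {l k : ℂ} (hl : l ∈ L) (hk : k ∉ L) : (F (k + l)).re = (F k).re := by
  obtain ⟨c, hc⟩ := C.per l hl
  rw [hc k hk]; simp

lemma add_mem_iff' {l k : ℂ} (hl : l ∈ L) : k + l ∈ L ↔ k ∈ L :=
  ⟨fun h => by simpa using L.sub_mem h hl, fun h => L.add_mem h hl⟩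

lemma Zt_add (C : Core L F) {l k : ℂ} (hl : l ∈ L) : k + l ∈ Zt L F ↔ k ∈ Zt L F := by
  unfold Zt
  by_cases hk : k ∈ L
  · simp [hk, L.add_mem hk hl]
  · have : k + l ∉ L := by rwa [add_mem_iff' hl]
    simp [hk, this, C.re_per hl hk]

lemma Ap_add (C : Core L F) {l k : ℂ} (hl : l ∈ L) : k + l ∈ Ap L F ↔ k ∈ Ap L F := by
  unfold Ap
  by_cases hk : k ∈ L
  · simp [hk, L.add_mem hk hl]
  · have : k + l ∉ L := by rwa [add_mem_iff' hl]
    simp [hk, this, C.re_per hl hk]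

lemma Zt_neg_mem (C : Core L F) {k : ℂ} : -k ∈ Zt L F ↔ k ∈ Zt L F := by
  simp [Zt, C.odd k]

lemma Ap_neg_mem (C : Core L F) {k : ℂ} : -k ∈ Ap L (fun k => -F k) ↔ k ∈ Ap L F := by
  simp [Ap, C.odd k]

lemma isOpen_Ap (C : Core L F) : IsOpen (Ap L F) := by
  rw [isOpen_iff_mem_nhds]
  rintro k ⟨hk, h⟩
  have h1 : ∀ᶠ x in 𝓝 k, x ∉ L := C.closed.isOpen_compl.mem_nhds hk
  have h2 : ∀ᶠ x in 𝓝 k, 0 < (F x).re :=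
    (continuous_re.continuousAt.comp (C.cont k hk)).eventually (lt_mem_nhds h)
  filter_upwards [h1, h2] with x a b using ⟨a, b⟩

lemma compl_Zt : (Zt L F)ᶜ = Ap L F ∪ Ap L (fun k => -F k) := by
  ext k
  simp only [Zt, Ap, mem_compl_iff, mem_ofPred_eq, mem_union, Complex.neg_re, Left.neg_pos_iff]
  constructor
  · intro h
    push Not at h
    rcases lt_or_gt_of_ne h.2 with h' | h'
    · exact Or.inr ⟨h.1, h'⟩
    · exact Or.inl ⟨h.1, h'⟩
  · rintro (⟨a, b⟩ | ⟨a, b⟩) (h | h)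
    · exact a h
    · exact b.ne' h
    · exact a h
    · exact b.ne h

lemma isClosed_Zt (C : Core L F) : IsClosed (Zt L F) := by
  rw [← isOpen_compl_iff, compl_Zt]
  exact C.isOpen_Ap.union C.neg.isOpen_Ap

/-- Unified chart. -/
lemma chart (C : Core L F) {z : ℂ} (hz : z ∈ Zt L F) :
    ∃ h : OpenPartialHomeomorph ℂ ℂ, z ∈ h.source ∧ h z = 0 ∧ (∃ ρ > 0, h.target = Metric.ball 0 ρ) ∧
      ∀ x ∈ h.source, (x ∈ Zt L F ↔ (h x).re = 0) ∧ (x ∈ Ap L F ↔ 0 < (h x).re) := by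
  suffices H : ∃ h : OpenPartialHomeomorph ℂ ℂ, z ∈ h.source ∧ h z = 0 ∧
      ∀ x ∈ h.source, (x ∈ Zt L F ↔ (h x).re = 0) ∧ (x ∈ Ap L F ↔ 0 < (h x).re) by
    obtain ⟨h, h1, h0, h2⟩ := H
    obtain ⟨ρ, hρ, hb⟩ := restr_ball h h1
    rw [h0] at hb
    refine ⟨h.trans (OpenPartialHomeomorph.ofSet (Metric.ball 0 ρ) Metric.isOpen_ball), ?_, ?_,
      ⟨ρ, hρ, ?_⟩, ?_⟩
    · simp [h1, h0, hρ]
    · simp [h0]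
    · ext x
      simp only [OpenPartialHomeomorph.trans_target, OpenPartialHomeomorph.ofSet_target,
        OpenPartialHomeomorph.ofSet_symm, OpenPartialHomeomorph.ofSet_apply, preimage_id,
        mem_inter_iff]
      exact ⟨fun a => a.1, fun a => ⟨a, hb a⟩⟩
    · intro x hx
      have : x ∈ h.source := by
        simp only [OpenPartialHomeomorph.trans_source, mem_inter_iff] at hx; exact hx.1
      simpa using h2 x this
  by_cases hL : z ∈ L
  · obtain ⟨h, h1, h0, h2⟩ := C.pole
    refine ⟨(Homeomorph.subRight z).toOpenPartialHomeomorph.trans h, by simpa using h1,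
      by simpa using h0, fun x hx => ?_⟩
    have hx' : x - z ∈ h.source := by simpa using hx
    have hZ : x ∈ Zt L F ↔ x - z ∈ Zt L F := by
      rw [sub_eq_add_neg, C.Zt_add (L.neg_mem hL)]
    have hA : x ∈ Ap L F ↔ x - z ∈ Ap L F := by
      rw [sub_eq_add_neg, C.Ap_add (L.neg_mem hL)]
    rw [hZ, hA]
    have hhx : ((Homeomorph.subRight z).toOpenPartialHomeomorph.trans h) x = h (x - z) := by simp
    rw [hhx]
    by_cases hxz : x - z = 0
    · rw [hxz, h0]; simp [Zt, Ap, L.zero_mem]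
    · obtain ⟨a, b, c⟩ := h2 _ hx' hxz
      rw [c, Complex.inv_re]
      have hb : 0 < normSq (F (x - z)) := normSq_pos.2 b
      simp only [Zt, Ap, mem_ofPred_eq, a, false_or, not_false_eq_true, true_and]
      constructor
      · rw [div_eq_zero_iff]; simp [hb.ne']
      · rw [div_pos_iff_of_pos_right hb]
  · have hre : (F z).re = 0 := by simpa [Zt, hL] using hz
    obtain ⟨h, h1, h2⟩ := C.reg z hL hre
    refine ⟨h.trans (Homeomorph.subRight (F z)).toOpenPartialHomeomorph, by simpa using h1,
      by simp [(h2 z h1).2], fun x hx => ?_⟩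
    have hx' : x ∈ h.source := by simpa using hx
    obtain ⟨a, b⟩ := h2 x hx'
    simp [Zt, Ap, a, b, hre]

lemma symm_image_conn (h : OpenPartialHomeomorph ℂ ℂ) {s : Set ℂ} (hs : Convex ℝ s)
    (hst : s ⊆ h.target) : IsPreconnected (h.symm '' s) :=
  hs.isPreconnected.image _ (h.continuousOn_symm.mono hst)

/-- Open neighbourhoods adapted to the sign decomposition. -/
lemma box (C : Core L F) {z : ℂ} (hz : z ∈ Zt L F) :
    ∃ U : Set ℂ, IsOpen U ∧ z ∈ U ∧ IsPreconnected (U ∩ Zt L F) ∧ IsPreconnected (U ∩ Ap L F) ∧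
      ∀ y ∈ U ∩ Zt L F, y ∈ closure (U ∩ Ap L F) := by
  obtain ⟨h, h1, h0, ⟨ρ, hρ, ht⟩, h2⟩ := C.chart hz
  have e1 : h.source ∩ Zt L F = h.symm '' (Metric.ball 0 ρ ∩ {w | w.re = 0}) := by
    ext x; constructor
    · rintro ⟨a, b⟩
      exact ⟨h x, ⟨ht ▸ h.map_source a, (h2 x a).1.1 b⟩, h.left_inv a⟩
    · rintro ⟨w, ⟨a, b⟩, rfl⟩
      rw [← ht] at a
      refine ⟨h.map_target a, (h2 _ (h.map_target a)).1.2 ?_⟩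
      rw [h.right_inv a]; exact b
  have e2 : h.source ∩ Ap L F = h.symm '' (Metric.ball 0 ρ ∩ {w | 0 < w.re}) := by
    ext x; constructor
    · rintro ⟨a, b⟩
      exact ⟨h x, ⟨ht ▸ h.map_source a, (h2 x a).2.1 b⟩, h.left_inv a⟩
    · rintro ⟨w, ⟨a, b⟩, rfl⟩
      rw [← ht] at a
      refine ⟨h.map_target a, (h2 _ (h.map_target a)).2.2 ?_⟩
      rw [h.right_inv a]; exact b
  refine ⟨h.source, h.open_source, h1, ?_, ?_, ?_⟩
  · rw [e1]
    refine symm_image_conn h ((convex_ball _ _).inter ?_) (by rw [ht]; exact inter_subset_left)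
    exact convex_hyperplane (IsLinearMap.mk (fun a b => by simp) (fun a b => by simp)) 0
  · rw [e2]
    refine symm_image_conn h ((convex_ball _ _).inter ?_) (by rw [ht]; exact inter_subset_left)
    exact convex_halfSpace_gt (IsLinearMap.mk (fun a b => by simp) (fun a b => by simp)) 0
  · rintro y ⟨hy, hyz⟩
    rw [e2]
    have hw : h y ∈ Metric.ball (0 : ℂ) ρ := ht ▸ h.map_source hy
    have hre : (h y).re = 0 := (h2 y hy).1.1 hyz
    have hcl : h y ∈ closure (Metric.ball 0 ρ ∩ {w : ℂ | 0 < w.re}) := by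
      have : Tendsto (fun t : ℝ => h y + t) (𝓝[>] 0) (𝓝 (h y)) := by
        have : Tendsto (fun t : ℝ => h y + t) (𝓝 0) (𝓝 (h y + (0 : ℝ))) :=
          (Continuous.tendsto (by fun_prop) 0)
        simpa using this.mono_left nhdsWithin_le_nhds
      refine mem_closure_of_tendsto this ?_
      filter_upwards [this (Metric.isOpen_ball.mem_nhds hw), self_mem_nhdsWithin] with t a b
      refine ⟨a, ?_⟩
      simp only [mem_ofPred_eq, add_re, hre, ofReal_re, zero_add]
      exact b
    have hc : ContinuousAt h.symm (h y) := h.continuousAt_symm (h.map_source hy)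
    have := hc.continuousWithinAt.mem_closure_image hcl
    rwa [h.left_inv hy] at this

end Core
end ZU

namespace ZU
open Topology
variable {L : AddSubgroup ℂ} {F : ℂ → ℂ}

/-- component of the positive set -/
def cp (L : AddSubgroup ℂ) (F : ℂ → ℂ) (x : ℂ) : Set ℂ := connectedComponentIn (Ap L F) x
/-- component of the zero set -/
def cz (L : AddSubgroup ℂ) (F : ℂ → ℂ) (x : ℂ) : Set ℂ := connectedComponentIn (Zt L F) x

/-- the component of `x` in the positive set is adjacent to `z` -/
def Adj (L : AddSubgroup ℂ) (F : ℂ → ℂ) (z x : ℂ) : Prop := x ∈ Ap L F ∧ z ∈ closure (cp L F x)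

lemma comp_image {A B : Set ℂ} (e : ℂ ≃ₜ ℂ) (h : ∀ x, e x ∈ B ↔ x ∈ A) (x : ℂ) (hx : x ∈ A) :
    connectedComponentIn B (e x) = e '' connectedComponentIn A x := by
  have hBA : e '' A = B := by
    ext y; constructor
    · rintro ⟨x, hx, rfl⟩; exact (h x).2 hx
    · intro hy; exact ⟨e.symm y, (h _).1 (by simpa using hy), by simp⟩
  rw [← hBA, e.image_connectedComponentIn hx]

namespace Core

lemma cp_add (C : Core L F) {l x : ℂ} (hl : l ∈ L) (hx : x ∈ Ap L F) :
    cp L F (x + l) = (fun y => y + l) '' cp L F x :=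
  comp_image (Homeomorph.addRight l) (fun _ => C.Ap_add hl) x hx

lemma cz_add (C : Core L F) {l x : ℂ} (hl : l ∈ L) (hx : x ∈ Zt L F) :
    cz L F (x + l) = (fun y => y + l) '' cz L F x :=
  comp_image (Homeomorph.addRight l) (fun _ => C.Zt_add hl) x hx

lemma cp_neg (C : Core L F) {x : ℂ} (hx : x ∈ Ap L F) :
    cp L (fun k => -F k) (-x) = (fun y => -y) '' cp L F x :=
  comp_image (Homeomorph.neg ℂ) (fun _ => C.Ap_neg_mem) x hx

lemma cp_congr_add (C : Core L F) {l x y : ℂ} (hl : l ∈ L) (hx : x ∈ Ap L F) (hy : y ∈ Ap L F)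
    (h : cp L F x = cp L F y) : cp L F (x + l) = cp L F (y + l) := by
  rw [C.cp_add hl hx, C.cp_add hl hy, h]

lemma adj_add (C : Core L F) {l z x : ℂ} (hl : l ∈ L) (h : Adj L F z x) :
    Adj L F (z + l) (x + l) := by
  refine ⟨(C.Ap_add hl).2 h.1, ?_⟩
  rw [C.cp_add hl h.1]
  have := (Homeomorph.addRight l).image_closure (cp L F x)
  have h2 : z + l ∈ Homeomorph.addRight l '' closure (cp L F x) := ⟨z, h.2, rfl⟩
  rw [this] at h2
  exact h2

lemma adj_neg (C : Core L F) {z x : ℂ} (h : Adj L F z x) :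
    Adj L (fun k => -F k) (-z) (-x) := by
  refine ⟨C.Ap_neg_mem.2 h.1, ?_⟩
  rw [C.cp_neg h.1]
  have := (Homeomorph.neg ℂ).image_closure (cp L F x)
  have h2 : -z ∈ Homeomorph.neg ℂ '' closure (cp L F x) := ⟨z, h.2, rfl⟩
  rw [this] at h2
  exact h2

lemma adj_congr {z x y : ℂ} (h : Adj L F z x) (hy : y ∈ Ap L F) (e : cp L F x = cp L F y) :
    Adj L F z y := ⟨hy, e ▸ h.2⟩

lemma adj_exists (C : Core L F) {z : ℂ} (hz : z ∈ Zt L F) : ∃ x, Adj L F z x := by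
  obtain ⟨U, hU, hzU, -, h2, h3⟩ := C.box hz
  have hc := h3 z ⟨hzU, hz⟩
  obtain ⟨x, hxU, hx⟩ := closure_nonempty_iff.1 ⟨z, hc⟩
  exact ⟨x, hx, closure_mono (h2.subset_connectedComponentIn ⟨hxU, hx⟩ inter_subset_right) hc⟩

lemma adj_box {U : Set ℂ} (hU : IsOpen U)
    (h2 : IsPreconnected (U ∩ Ap L F)) {z x : ℂ} (hz : z ∈ U) (h : Adj L F z x) :
    U ∩ Ap L F ⊆ cp L F x := by
  obtain ⟨y, hyU, hy⟩ := mem_closure_iff.1 h.2 U hU hz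
  have hyA : y ∈ Ap L F := connectedComponentIn_subset _ _ hy
  have := h2.subset_connectedComponentIn ⟨hyU, hyA⟩ inter_subset_right
  rwa [← connectedComponentIn_eq hy] at this

lemma adj_unique (C : Core L F) {z x y : ℂ} (hz : z ∈ Zt L F) (h : Adj L F z x)
    (h' : Adj L F z y) : cp L F x = cp L F y := by
  obtain ⟨U, hU, hzU, -, h2, h3⟩ := C.box hz
  obtain ⟨w, hw⟩ := closure_nonempty_iff.1 ⟨z, h3 z ⟨hzU, hz⟩⟩
  have a := adj_box hU h2 hzU h hw
  have b := adj_box hU h2 hzU h' hw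
  exact (connectedComponentIn_eq a).trans (connectedComponentIn_eq b).symm

lemma adj_along (C : Core L F) {T : Set ℂ} (hT : IsPreconnected T) (hTZ : T ⊆ Zt L F) {z z' x : ℂ}
    (hz : z ∈ T) (hz' : z' ∈ T) (h : Adj L F z x) : Adj L F z' x := by
  by_contra hn
  have hcl : z' ∉ closure (cp L F x) := fun hh => hn ⟨h.1, hh⟩
  set V : Set ℂ := ⋃₀ {U | IsOpen U ∧ ∀ y ∈ U ∩ Zt L F, y ∈ closure (cp L F x)} with hV
  have hVo : IsOpen V := isOpen_sUnion fun U hU => hU.1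
  have hVc : ∀ y ∈ Zt L F, y ∈ closure (cp L F x) → y ∈ V := by
    intro y hy hyc
    obtain ⟨U, hU, hyU, -, h2, h3⟩ := C.box hy
    refine ⟨U, ⟨hU, fun w hw => ?_⟩, hyU⟩
    exact closure_mono (adj_box hU h2 hyU ⟨h.1, hyc⟩) (h3 w hw)
  obtain ⟨y, hyT, hyV, hy2⟩ := hT V (closure (cp L F x))ᶜ hVo isClosed_closure.isOpen_compl
    (fun y hy => by
      by_cases hyc : y ∈ closure (cp L F x)
      · exact Or.inl (hVc y (hTZ hy) hyc)
      · exact Or.inr hyc) ⟨z, hz, hVc z (hTZ hz) h.2⟩ ⟨z', hz', hcl⟩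
  obtain ⟨U, hU, hyU⟩ := hyV
  exact hy2 (hU.2 y ⟨hyU, hTZ hyT⟩)

lemma saturated_closed (C : Core L F) {S : Set ℂ} (hS : S ⊆ Zt L F) (h : ∀ z ∈ S, cz L F z ⊆ S) :
    IsClosed S := by
  rw [← closure_subset_iff_isClosed]
  intro z hz
  have hzZ : z ∈ Zt L F := C.isClosed_Zt.closure_subset_iff.2 hS hz
  obtain ⟨U, hU, hzU, h1, -, -⟩ := C.box hzZ
  obtain ⟨s, hsU, hs⟩ := mem_closure_iff.1 hz U hU hzU
  exact h s hs (h1.subset_connectedComponentIn ⟨hsU, hS hs⟩ inter_subset_right ⟨hzU, hzZ⟩)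

lemma saturated_compl {S : Set ℂ} (h : ∀ z ∈ S, cz L F z ⊆ S) :
    ∀ z ∈ Zt L F \ S, cz L F z ⊆ Zt L F \ S := by
  rintro z ⟨hz, hzS⟩ y hy
  refine ⟨connectedComponentIn_subset _ _ hy, fun hyS => hzS (h y hyS ?_)⟩
  have : cz L F z = cz L F y := connectedComponentIn_eq hy
  rw [← this]
  exact mem_connectedComponentIn hz

end Core

lemma int_of_circle {θ : ℝ} (h : Circle.exp (Real.pi * θ) = 1) : ∃ n : ℤ, θ = 2 * n := by
  rw [Circle.exp_eq_one] at h
  obtain ⟨n, hn⟩ := h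
  refine ⟨n, ?_⟩
  have := Real.pi_pos
  have h2 : Real.pi * θ = Real.pi * (2 * n) := by rw [hn]; ring
  exact mul_left_cancel₀ this.ne' h2

lemma circle_lift (E : ℂ → Circle) (hE : Continuous E) :
    ∃ θ : ℂ → ℝ, Continuous θ ∧ ∀ k, Circle.exp (Real.pi * θ k) = E k := by
  obtain ⟨e0, he0⟩ : ∃ e0, Circle.exp e0 = E 0 := ⟨Complex.arg (E 0), Circle.exp_arg _⟩
  obtain ⟨G, ⟨-, hG⟩, -⟩ := Circle.isCoveringMap_exp.existsUnique_continuousMap_lifts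
    (⟨E, hE⟩ : C(ℂ, Circle)) 0 e0 he0
  refine ⟨fun k => G k / Real.pi, by fun_prop, fun k => ?_⟩
  rw [mul_div_cancel₀ _ Real.pi_pos.ne']
  exact congrFun hG k

/-- integer index constant on preconnected sets -/
lemma index_const {θ : ℂ → ℝ} (hθ : Continuous θ) {T : Set ℂ} (hT : IsPreconnected T)
    {N : ℂ → ℤ} {a b : ℝ} (hab : b - a < 2)
    (hN : ∀ x ∈ T, a + 2 * N x ≤ θ x ∧ θ x ≤ b + 2 * N x) {x y : ℂ}
    (hx : x ∈ T) (hy : y ∈ T) : N x = N y := by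
  by_contra hne
  wlog hlt : N x < N y generalizing x y
  · exact this hy hx (Ne.symm hne) (lt_of_le_of_ne (not_lt.1 hlt) (Ne.symm hne))
  have hpc : IsPreconnected (θ '' T) := hT.image _ hθ.continuousOn
  have h1 := hN x hx
  have h2 := hN y hy
  have hlt' : (N x : ℝ) + 1 ≤ N y := by exact_mod_cast hlt
  set m : ℝ := b + 2 * N x + (2 - (b - a)) / 2 with hm
  have hmem : m ∈ θ '' T := hpc.ordConnected.out ⟨x, hx, rfl⟩ ⟨y, hy, rfl⟩
    ⟨by linarith, by linarith⟩
  obtain ⟨w, hw, hwm⟩ := hmem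
  have h3 := hN w hw
  rcases lt_trichotomy (N w) (N x) with h | h | h
  · have : (N w : ℝ) < N x := by exact_mod_cast h
    linarith
  · rw [h] at h3; linarith
  · have : (N x : ℝ) + 1 ≤ N w := by exact_mod_cast h
    linarith

namespace Core

/-- The crossing lemma. -/
lemma crossing (C : Core L F) {S : Set ℂ} (hS : S ⊆ Zt L F) (hsat : ∀ z ∈ S, cz L F z ⊆ S) :
    ∃ NP NM : ℂ → ℤ,
      (∀ x ∈ Ap L F, ∀ y, cp L F x = cp L F y → NP x = NP y) ∧
      (∀ x ∈ Ap L (fun k => -F k), ∀ y, cp L (fun k => -F k) x = cp L (fun k => -F k) y →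
        NM x = NM y) ∧
      ∀ z ∈ Zt L F, ∀ x y, Adj L F z x → Adj L (fun k => -F k) z y →
        (z ∈ S → NM y = NP x + 1) ∧ (z ∉ S → NM y = NP x) := by
  have hScl := C.saturated_closed hS hsat
  have hTcl : IsClosed (Zt L F \ S) := C.saturated_closed sdiff_subset (saturated_compl hsat)
  obtain ⟨ψ, h0, h1, h01⟩ := exists_continuous_zero_one_of_isClosed hTcl hScl disjoint_sdiff_left
  classical
  set A := Ap L F with hA
  set B := Ap L (fun k => -F k) with hB
  set E : ℂ → Circle := fun k => if k ∈ A then Circle.exp (Real.pi * ψ k)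
    else Circle.exp (-(Real.pi * ψ k)) with hEdef
  have hZψ : ∀ k ∈ Zt L F, Circle.exp (Real.pi * ψ k) = Circle.exp (-(Real.pi * ψ k)) := by
    intro k hk
    by_cases hkS : k ∈ S
    · rw [h1 hkS]
      ext; simp [Circle.coe_exp, Complex.exp_neg]
    · rw [h0 ⟨hk, hkS⟩]; simp
  have hEc : Continuous E := by
    refine Continuous.if ?_ (by fun_prop) (by fun_prop)
    intro k hk
    apply hZψ
    by_contra hkZ
    have : k ∈ (Zt L F)ᶜ := hkZ
    rw [compl_Zt] at this
    have hfr : k ∈ frontier A := hk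
    rcases this with h | h
    · exact (C.isOpen_Ap.frontier_eq ▸ hfr).2 h
    · obtain ⟨y, hy1, hy2⟩ := mem_closure_iff.1 (frontier_subset_closure hfr) B C.neg.isOpen_Ap h
      have a : 0 < (F y).re := hy2.2
      have b : 0 < (-F y).re := hy1.2
      simp at b
      linarith
  obtain ⟨θ, hθ, hθE⟩ := circle_lift E hEc
  have hBA : ∀ k ∈ B, k ∉ A := by
    intro k hb ha
    have a : 0 < (F k).re := ha.2
    have b : 0 < (-F k).re := hb.2
    simp at b
    linarith
  have hP : ∀ k ∈ A, ∃ n : ℤ, 0 + 2 * n ≤ θ k ∧ θ k ≤ 1 + 2 * n := by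
    intro k hk
    have : Circle.exp (Real.pi * (θ k - ψ k)) = 1 := by
      rw [mul_sub, Circle.exp_sub, hθE, hEdef]; simp [hk]
    obtain ⟨n, hn⟩ := int_of_circle this
    have := h01 k
    exact ⟨n, by linarith [this.1], by linarith [this.2]⟩
  have hM : ∀ k ∈ B, ∃ n : ℤ, -1 + 2 * n ≤ θ k ∧ θ k ≤ 0 + 2 * n := by
    intro k hk
    have : Circle.exp (Real.pi * (θ k + ψ k)) = 1 := by
      rw [mul_add, Circle.exp_add, hθE, hEdef]; simp [hBA k hk, Circle.exp_neg]
    obtain ⟨n, hn⟩ := int_of_circle this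
    have := h01 k
    exact ⟨n, by linarith [this.2], by linarith [this.1]⟩
  choose! NP hNP using hP
  choose! NM hNM using hM
  have hcP : ∀ x ∈ A, ∀ y, cp L F x = cp L F y → NP x = NP y := by
    intro x hx y hxy
    have hyA : y ∈ A := by
      by_contra hy
      have h1 : cp L F y = ∅ := connectedComponentIn_eq_empty hy
      have h2 : x ∈ cp L F x := mem_connectedComponentIn hx
      rw [hxy, h1] at h2; exact h2
    exact index_const hθ (isPreconnected_connectedComponentIn (x := x) (F := A)) (by norm_num)
      (fun w hw => hNP w (connectedComponentIn_subset _ _ hw)) (mem_connectedComponentIn hx)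
      (by have : y ∈ cp L F y := mem_connectedComponentIn hyA
          rw [← hxy] at this; exact this)
  have hcM : ∀ x ∈ B, ∀ y, cp L (fun k => -F k) x = cp L (fun k => -F k) y → NM x = NM y := by
    intro x hx y hxy
    have hyA : y ∈ B := by
      by_contra hy
      have h1 : cp L (fun k => -F k) y = ∅ := connectedComponentIn_eq_empty hy
      have h2 : x ∈ cp L (fun k => -F k) x := mem_connectedComponentIn hx
      rw [hxy, h1] at h2; exact h2
    exact index_const hθ (isPreconnected_connectedComponentIn (x := x) (F := B)) (by norm_num)
      (fun w hw => hNM w (connectedComponentIn_subset _ _ hw)) (mem_connectedComponentIn hx)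
      (by have : y ∈ cp L (fun k => -F k) y := mem_connectedComponentIn hyA
          rw [← hxy] at this; exact this)
  refine ⟨NP, NM, hcP, hcM, ?_⟩
  intro z hz x y hx hy
  have hnear : IsOpen {w | |θ w - θ z| < 1 / 2} :=
    isOpen_lt (by fun_prop) (by fun_prop)
  have hzn : z ∈ {w | |θ w - θ z| < 1 / 2} := by simp
  obtain ⟨x', hx'1, hx'2⟩ := mem_closure_iff.1 hx.2 _ hnear hzn
  obtain ⟨y', hy'1, hy'2⟩ := mem_closure_iff.1 hy.2 _ hnear hzn
  have hx'A : x' ∈ A := connectedComponentIn_subset _ _ hx'2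
  have hy'B : y' ∈ B := connectedComponentIn_subset _ _ hy'2
  rw [hcP x hx.1 x' (connectedComponentIn_eq hx'2), hcM y hy.1 y' (connectedComponentIn_eq hy'2)]
  have p := hNP x' hx'A
  have q := hNM y' hy'B
  have p' : |θ x' - θ z| < 1 / 2 := hx'1
  have q' : |θ y' - θ z| < 1 / 2 := hy'1
  rw [abs_lt] at p' q'
  have hzA : z ∉ A := by
    rintro ⟨a, b⟩
    rcases hz with h | h
    · exact a h
    · exact b.ne' h
  constructor
  · intro hzS
    have : Circle.exp (Real.pi * (θ z + 1)) = 1 := by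
      rw [mul_add, Circle.exp_add, hθE, hEdef]; simp [hzA, Circle.exp_neg, h1 hzS]
    obtain ⟨n, hn⟩ := int_of_circle this
    have e1 : NP x' = n - 1 := by
      have a1 : (NP x' : ℝ) < (n - 1 : ℤ) + 1 := by push_cast; linarith
      have a2 : ((n - 1 : ℤ) : ℝ) < NP x' + 1 := by push_cast; linarith
      have a1' : NP x' < n - 1 + 1 := by exact_mod_cast a1
      have a2' : n - 1 < NP x' + 1 := by exact_mod_cast a2
      omega
    have e2 : NM y' = n := by
      have a1 : (NM y' : ℝ) < n + 1 := by linarith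
      have a2 : (n : ℝ) < NM y' + 1 := by linarith
      have a1' : NM y' < n + 1 := by exact_mod_cast a1
      have a2' : n < NM y' + 1 := by exact_mod_cast a2
      omega
    omega
  · intro hzS
    have : Circle.exp (Real.pi * θ z) = 1 := by
      rw [hθE, hEdef]; simp [hzA, h0 ⟨hz, hzS⟩]
    obtain ⟨n, hn⟩ := int_of_circle this
    have e1 : NP x' = n := by
      have a1 : (NP x' : ℝ) < n + 1 := by linarith
      have a2 : (n : ℝ) < NP x' + 1 := by linarith
      have a1' : NP x' < n + 1 := by exact_mod_cast a1
      have a2' : n < NP x' + 1 := by exact_mod_cast a2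
      omega
    have e2 : NM y' = n := by
      have a1 : (NM y' : ℝ) < n + 1 := by linarith
      have a2 : (n : ℝ) < NM y' + 1 := by linarith
      have a1' : NM y' < n + 1 := by exact_mod_cast a1
      have a2' : n < NM y' + 1 := by exact_mod_cast a2
      omega
    omega

end Core
end ZU

namespace ZU
open Topology
variable {L : AddSubgroup ℂ} {F : ℂ → ℂ}
namespace Core

lemma adj_zero (C : Core L F) {x : ℂ} (hx : x ∈ Ap L F) : ∃ l ∈ L, Adj L F 0 (x + l) := by
  by_contra hcon
  push Not at hcon
  have h0Z : (0 : ℂ) ∈ Zt L F := Or.inl L.zero_mem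
  obtain ⟨U, hU, h0U, -, h2, h3⟩ := C.box h0Z
  set D : Set ℂ := {y | ∃ l ∈ L, y ∈ cp L F (x + l)} with hD
  have hDA : D ⊆ Ap L F := by
    rintro y ⟨l, hl, hy⟩; exact connectedComponentIn_subset _ _ hy
  have hDadd : ∀ y ∈ D, ∀ l ∈ L, y + l ∈ D := by
    rintro y ⟨l, hl, hy⟩ l' hl'
    refine ⟨l + l', L.add_mem hl hl', ?_⟩
    rw [← add_assoc, C.cp_add hl' ((C.Ap_add hl).2 hx)]
    exact ⟨y, hy, rfl⟩
  have hUD : ∀ y ∈ U, y ∉ D := by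
    rintro y hyU ⟨l, hl, hy⟩
    have hyA : y ∈ Ap L F := connectedComponentIn_subset _ _ hy
    have := h2.subset_connectedComponentIn ⟨hyU, hyA⟩ inter_subset_right
    rw [← connectedComponentIn_eq hy] at this
    exact hcon l hl ⟨(C.Ap_add hl).2 hx, closure_mono this (h3 0 ⟨h0U, h0Z⟩)⟩
  have hclL : ∀ y ∈ closure D, y ∉ L := by
    intro y hy hyL
    have hV : IsOpen ((fun w => w + -y) ⁻¹' U) := hU.preimage (by fun_prop)
    obtain ⟨w, hw1, hw2⟩ := mem_closure_iff.1 hy _ hV (by simpa using h0U)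
    exact hUD _ hw1 (hDadd w hw2 _ (L.neg_mem hyL))
  obtain ⟨K, hK, hKL⟩ := C.cpt
  have hM : IsCompact (K ∩ closure D) := hK.inter_right isClosed_closure
  have hxD : x ∈ D := ⟨0, L.zero_mem, by rw [add_zero]; exact mem_connectedComponentIn hx⟩
  obtain ⟨l0, hl0, hx0⟩ := hKL x
  obtain ⟨k0, hk0, hmax⟩ := hM.exists_isMaxOn ⟨x + l0, hx0, subset_closure (hDadd x hxD _ hl0)⟩
    (f := fun k => (F k).re)
    (fun k hk => (continuous_re.continuousAt.comp (C.cont k (hclL k hk.2))).continuousWithinAt)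
  have hmax' : ∀ y ∈ D, (F y).re ≤ (F k0).re := by
    intro y hy
    obtain ⟨l, hl, hyl⟩ := hKL y
    have := hmax ⟨hyl, subset_closure (hDadd y hy l hl)⟩
    simp only [Set.mem_ofPred_eq] at this
    rwa [C.re_per hl (hDA hy).1] at this
  have hk0L := hclL k0 hk0.2
  have hk0A : k0 ∈ Ap L F := ⟨hk0L, lt_of_lt_of_le hx.2 (hmax' x hxD)⟩
  have hopen : IsOpen (cp L F k0) := C.isOpen_Ap.connectedComponentIn
  have hself : k0 ∈ cp L F k0 := mem_connectedComponentIn hk0A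
  obtain ⟨w, hw1, l, hl, hw2⟩ := mem_closure_iff.1 hk0.2 _ hopen hself
  have hsub : cp L F k0 ⊆ D := by
    intro y hy
    refine ⟨l, hl, ?_⟩
    have e1 : cp L F k0 = cp L F w := connectedComponentIn_eq hw1
    have e2 : cp L F (x + l) = cp L F w := connectedComponentIn_eq hw2
    rw [e2, ← e1]; exact hy
  have hnh : F '' cp L F k0 ∈ 𝓝 (F k0) := by
    refine C.opn k0 hk0L ?_
    show F ⁻¹' (F '' cp L F k0) ∈ 𝓝 k0
    exact Filter.mem_of_superset (hopen.mem_nhds hself) (subset_preimage_image _ _)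
  have ht : Tendsto (fun t : ℝ => F k0 + t) (𝓝[>] 0) (𝓝 (F k0)) := by
    have : Tendsto (fun t : ℝ => F k0 + t) (𝓝 0) (𝓝 (F k0 + (0 : ℝ))) :=
      (Continuous.tendsto (by fun_prop) 0)
    simpa using this.mono_left nhdsWithin_le_nhds
  obtain ⟨t, ⟨y, hy, hyt⟩, htp⟩ := ((ht.eventually hnh).and self_mem_nhdsWithin).exists
  have := hmax' y (hsub hy)
  rw [hyt] at this
  simp at this
  have htp' : 0 < t := htp
  linarith

lemma cp_conn (C : Core L F) {x y : ℂ} (hx : x ∈ Ap L F) (hy : y ∈ Ap L F) :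
    ∃ l ∈ L, cp L F x = cp L F (y + l) := by
  obtain ⟨l, hl, h⟩ := C.adj_zero hx
  obtain ⟨l', hl', h'⟩ := C.adj_zero hy
  have := C.cp_congr_add (L.neg_mem hl) h.1 h'.1 (C.adj_unique (Or.inl L.zero_mem) h h')
  refine ⟨l' + -l, L.add_mem hl' (L.neg_mem hl), ?_⟩
  rw [← add_assoc, ← this]; simp

lemma stab (C : Core L F) {w x l : ℂ} (hw : w ∈ Zt L F) (h2w : 2 * w ∈ L) (hx : Adj L F w x)
    (hl : l ∈ L) : cp L F (x + l) = cp L F x ↔ w + l ∈ cz L F w := by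
  have hwl : w + l ∈ Zt L F := (C.Zt_add hl).2 hw
  constructor
  · intro h
    by_contra hn
    obtain ⟨NP, NM, -, -, hN⟩ := C.crossing (S := cz L F w) (connectedComponentIn_subset _ _)
      (fun z hz => by
        have : cz L F w = cz L F z := connectedComponentIn_eq hz
        rw [this])
    have hy : Adj L (fun k => -F k) w (-x + 2 * w) := by
      have := C.neg.adj_add h2w (C.adj_neg hx)
      have e : -w + 2 * w = w := by ring
      rwa [e] at this
    have hx' : Adj L F (w + l) x := adj_congr (C.adj_add hl hx) hx.1 h
    have hy' : Adj L (fun k => -F k) (w + l) (-x + 2 * w) := by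
      refine adj_congr (C.neg.adj_add hl hy) hy.1 ?_
      have h3 : cp L F x = cp L F (x + -l) := by
        have := C.cp_congr_add (L.neg_mem hl) ((C.Ap_add hl).2 hx.1) hx.1 h
        simpa using this
      have h4 : cp L (fun k => -F k) (-x) = cp L (fun k => -F k) (-(x + -l)) := by
        rw [C.cp_neg hx.1, C.cp_neg ((C.Ap_add (L.neg_mem hl)).2 hx.1), h3]
      have h5 := C.neg.cp_congr_add h2w (C.Ap_neg_mem.2 hx.1)
        (C.Ap_neg_mem.2 ((C.Ap_add (L.neg_mem hl)).2 hx.1)) h4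
      rw [h5]
      congr 1; ring
    have a := (hN w hw x _ hx hy).1 (mem_connectedComponentIn hw)
    have b := (hN (w + l) hwl x _ hx' hy').2 hn
    omega
  · intro h
    have h1 : Adj L F (w + l) x := C.adj_along isPreconnected_connectedComponentIn
      (connectedComponentIn_subset _ _) (mem_connectedComponentIn hw) h hx
    exact C.adj_unique hwl (C.adj_add hl hx) h1

lemma stab_iff (C : Core L F) {w l : ℂ} (hw : w ∈ Zt L F) (h2w : 2 * w ∈ L) (hl : l ∈ L) :
    l ∈ cz L F 0 ↔ w + l ∈ cz L F w := by
  have h0 : (0 : ℂ) ∈ Zt L F := Or.inl L.zero_mem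
  obtain ⟨x, hx⟩ := C.adj_exists h0
  obtain ⟨y, hy⟩ := C.adj_exists hw
  have a := C.stab h0 (by simp [L.zero_mem]) hx hl
  have b := C.stab hw h2w hy hl
  rw [zero_add] at a
  rw [← a, ← b]
  obtain ⟨m, hm, hxy⟩ := C.cp_conn hx.1 hy.1
  have hyl := (C.Ap_add hl).2 hy.1
  have hym := (C.Ap_add hm).2 hy.1
  have e : cp L F (x + l) = cp L F (y + l + m) := by
    rw [C.cp_congr_add hl hx.1 hym hxy]; congr 1; ring
  rw [e, hxy]
  constructor
  · intro h
    have := C.cp_congr_add (L.neg_mem hm) ((C.Ap_add hm).2 hyl) hym h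
    simpa using this
  · intro h
    exact C.cp_congr_add hm hyl hy.1 h

/-- shift behaviour of an index along a lattice -/
lemma shift_int {a : ℂ → ℤ} {m : ℂ} {d : ℤ} (hm : m ∈ L) (h : ∀ l ∈ L, a (l + m) = a l + d)
    (n : ℤ) : ∀ l ∈ L, a (l + n * m) = a l + n * d := by
  induction n using Int.induction_on with
  | zero => intro l hl; simp
  | succ i ih =>
    intro l hl
    have hi : (i : ℂ) * m ∈ L := by simpa using L.nsmul_mem hm i
    have e : l + ((i : ℤ) + 1 : ℤ) * m = (l + (i : ℤ) * m) + m := by push_cast; ring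
    rw [e, h _ (L.add_mem hl (by simpa using hi)), ih l hl]; push_cast; ring
  | pred i ih =>
    intro l hl
    have hi : -(i : ℂ) * m ∈ L := by simpa using L.neg_mem (L.nsmul_mem hm i)
    have hi2 : -(i : ℂ) * m - m ∈ L := L.sub_mem hi hm
    have e : l + (-(i : ℤ) - 1 : ℤ) * m = l + (-(i : ℂ) * m - m) := by push_cast; ring
    have := h _ (L.add_mem hl hi2)
    have e2 : l + (-(i : ℂ) * m - m) + m = l + (-(i : ℤ) : ℤ) * m := by push_cast; ring
    rw [e2, ih l hl] at this
    rw [e]; push_cast at *; linarith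

/-- index shifts for a lattice-invariant union of curves -/
lemma index_shift (C : Core L F) {z l₀ x₀ y₀ : ℂ} (hz : z ∈ Zt L F)
    (hx₀ : Adj L F 0 x₀) (hy₀ : Adj L (fun k => -F k) 0 y₀)
    (hl₀ : l₀ ∈ L) (hl₀z : l₀ ∈ cz L F 0)
    (h0z : ∀ l ∈ L, l ∉ cz L F z) :
    ∃ a : ℂ → ℤ, (∀ l ∈ L, a (l + l₀) = a l) ∧
      ∀ w ∈ Zt L F, ∀ α ∈ L, ∀ β ∈ L, Adj L F w (x₀ + α) → Adj L (fun k => -F k) w (y₀ + β) →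
      ((∃ l ∈ L, w + l ∈ cz L F z) → ∀ l ∈ L, a (l + (β - α)) = a l + 1) ∧
      ((∀ l ∈ L, w + l ∉ cz L F z) → ∀ l ∈ L, a (l + (β - α)) = a l) := by
  have h0 : (0 : ℂ) ∈ Zt L F := Or.inl L.zero_mem
  obtain ⟨NP, NM, hP, hM, hN⟩ := C.crossing (S := {w | ∃ l ∈ L, w + l ∈ cz L F z})
    (by rintro w ⟨l, hl, hw⟩; exact (C.Zt_add hl).1 (connectedComponentIn_subset _ _ hw))
    (by
      rintro w ⟨l, hl, hw⟩ y hy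
      have hwZ : w ∈ Zt L F := (C.Zt_add hl).1 (connectedComponentIn_subset _ _ hw)
      refine ⟨l, hl, ?_⟩
      have e : cz L F z = cz L F (w + l) := connectedComponentIn_eq hw
      rw [e, C.cz_add hl hwZ]
      exact ⟨y, hy, rfl⟩)
  refine ⟨fun l => NP (x₀ + l), ?_, ?_⟩
  · intro l hl
    have := (C.stab h0 (by simp [L.zero_mem]) hx₀ hl₀).2 (by simpa using hl₀z)
    have h2 := C.cp_congr_add hl ((C.Ap_add hl₀).2 hx₀.1) hx₀.1 this
    have e : x₀ + (l + l₀) = x₀ + l₀ + l := by ring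
    simp only [e]
    exact hP _ ((C.Ap_add hl).2 ((C.Ap_add hl₀).2 hx₀.1)) _ h2
  · have hb : ∀ l ∈ L, NM (y₀ + l) = NP (x₀ + l) := by
      intro l hl
      refine (hN (0 + l) ((C.Zt_add hl).2 h0) _ _ (C.adj_add hl hx₀) (C.neg.adj_add hl hy₀)).2 ?_
      rintro ⟨l', hl', hh⟩
      exact h0z (0 + l + l') (by simpa using L.add_mem hl hl') hh
    intro w hw α hα β hβ hA hB
    have key : ∀ l ∈ L, _ := fun l hl =>
      hN (w + (l - α)) ((C.Zt_add (L.sub_mem hl hα)).2 hw) _ _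
        (C.adj_add (L.sub_mem hl hα) hA) (C.neg.adj_add (L.sub_mem hl hα) hB)
    constructor
    · rintro ⟨m, hm, hwm⟩ l hl
      have := (key l hl).1 ⟨m - (l - α), L.sub_mem hm (L.sub_mem hl hα), by
        have e : w + (l - α) + (m - (l - α)) = w + m := by ring
        rwa [e]⟩
      have e1 : y₀ + β + (l - α) = y₀ + (l + (β - α)) := by ring
      have e2 : x₀ + α + (l - α) = x₀ + l := by ring
      rw [e1, e2, hb _ (L.add_mem hl (L.sub_mem hβ hα))] at this
      exact this
    · intro hwm l hl
      have := (key l hl).2 (by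
        rintro ⟨m, hm, hh⟩
        refine hwm (l - α + m) (L.add_mem (L.sub_mem hl hα) hm) ?_
        rwa [← add_assoc])
      have e1 : y₀ + β + (l - α) = y₀ + (l + (β - α)) := by ring
      have e2 : x₀ + α + (l - α) = x₀ + l := by ring
      rw [e1, e2, hb _ (L.add_mem hl (L.sub_mem hβ hα))] at this
      exact this

/-- There is no third curve. -/
lemma no_third (C : Core L F) {z w l₀ : ℂ} (hz : z ∈ Zt L F) (hw : w ∈ Zt L F)
    (hl₀ : l₀ ∈ L) (hl₀z : l₀ ∈ cz L F 0)
    (hrank : ∀ a ∈ L, ∀ b ∈ L, ∃ p q r : ℤ, (p ≠ 0 ∨ q ≠ 0) ∧ (p : ℂ) * a + q * b + r * l₀ = 0)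
    (h0z : ∀ l ∈ L, l ∉ cz L F z) (h0w : ∀ l ∈ L, l ∉ cz L F w)
    (hzw : ∀ l ∈ L, w + l ∉ cz L F z) : False := by
  have h0 : (0 : ℂ) ∈ Zt L F := Or.inl L.zero_mem
  obtain ⟨x₀, hx₀⟩ := C.adj_exists h0
  obtain ⟨y₀, hy₀⟩ := C.neg.adj_exists (z := 0) (by rw [Zt_neg]; exact h0)
  have ex : ∀ v ∈ Zt L F, ∃ α ∈ L, Adj L F v (x₀ + α) := by
    intro v hv
    obtain ⟨x, hx⟩ := C.adj_exists hv
    obtain ⟨l, hl, e⟩ := C.cp_conn hx.1 hx₀.1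
    exact ⟨l, hl, adj_congr hx ((C.Ap_add hl).2 hx₀.1) e⟩
  have ey : ∀ v ∈ Zt L F, ∃ α ∈ L, Adj L (fun k => -F k) v (y₀ + α) := by
    intro v hv
    obtain ⟨x, hx⟩ := C.neg.adj_exists (z := v) (by rw [Zt_neg]; exact hv)
    obtain ⟨l, hl, e⟩ := C.neg.cp_conn hx.1 hy₀.1
    exact ⟨l, hl, adj_congr hx ((C.neg.Ap_add hl).2 hy₀.1) e⟩
  obtain ⟨α, hα, hA⟩ := ex z hz
  obtain ⟨β, hβ, hB⟩ := ey z hz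
  obtain ⟨α', hα', hA'⟩ := ex w hw
  obtain ⟨β', hβ', hB'⟩ := ey w hw
  have hwz : ∀ l ∈ L, z + l ∉ cz L F w := by
    intro l hl h
    have e : cz L F w = cz L F (z + l) := connectedComponentIn_eq h
    refine hzw (-l) (L.neg_mem hl) ?_
    have : w ∈ cz L F (z + l) := e ▸ mem_connectedComponentIn hw
    rw [C.cz_add hl hz] at this
    obtain ⟨y, hy, hyw⟩ := this
    simp only at hyw
    rw [← hyw]; simpa using hy
  obtain ⟨a, ha0, ha⟩ := C.index_shift hz hx₀ hy₀ hl₀ hl₀z h0z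
  obtain ⟨b, hb0, hb⟩ := C.index_shift hw hx₀ hy₀ hl₀ hl₀z h0w
  have a1 := (ha z hz α hα β hβ hA hB).1 ⟨0, L.zero_mem, by rw [add_zero]; exact mem_connectedComponentIn hz⟩
  have a2 := (ha w hw α' hα' β' hβ' hA' hB').2 hzw
  have b1 := (hb z hz α hα β hβ hA hB).2 hwz
  have b2 := (hb w hw α' hα' β' hβ' hA' hB').1
    ⟨0, L.zero_mem, by rw [add_zero]; exact mem_connectedComponentIn hw⟩
  have hμ := L.sub_mem hβ hα
  have hμ' := L.sub_mem hβ' hα'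
  obtain ⟨p, q, r, hpq, hrel⟩ := hrank _ hμ _ hμ'
  have zm : ∀ (n : ℤ) {m : ℂ}, m ∈ L → (n : ℂ) * m ∈ L := fun n m hm => by
    simpa using L.zsmul_mem hm n
  have e : (0 : ℂ) + p * (β - α) + q * (β' - α') + r * l₀ = 0 := by rw [zero_add]; exact hrel
  have m1 : (0 : ℂ) + p * (β - α) ∈ L := L.add_mem L.zero_mem (zm p hμ)
  have m2 := L.add_mem m1 (zm q hμ')
  have A1 := shift_int (a := a) hl₀ (d := 0) (by simpa using ha0) r _ m2
  rw [e, shift_int (a := a) hμ' (d := 0) (by simpa using a2) q _ m1, shift_int (a := a) hμ a1 p _ L.zero_mem] at A1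
  have B1 := shift_int (a := b) hl₀ (d := 0) (by simpa using hb0) r _ m2
  rw [e, shift_int (a := b) hμ' b2 q _ m1, shift_int (a := b) hμ (d := 0) (by simpa using b1) p _ L.zero_mem] at B1
  have : p = 0 := by linarith
  have : q = 0 := by linarith
  tauto

end Core
end ZU

namespace ZU
open Topology
variable {L : AddSubgroup ℂ} {F : ℂ → ℂ}

/-- local sections of `F` over the imaginary axis -/
def LiftOn (L : AddSubgroup ℂ) (F : ℂ → ℂ) (g : ℝ → ℂ) (s : Set ℝ) : Prop :=
  ContinuousOn g s ∧ ∀ t ∈ s, g t ∉ L ∧ F (g t) = t * I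

/-- global sections of `F` over the imaginary axis -/
def Lift (L : AddSubgroup ℂ) (F : ℂ → ℂ) (g : ℝ → ℂ) : Prop :=
  Continuous g ∧ ∀ t : ℝ, g t ∉ L ∧ F (g t) = t * I

lemma Lift.on {g : ℝ → ℂ} (h : Lift L F g) (s : Set ℝ) : LiftOn L F g s :=
  ⟨h.1.continuousOn, fun t _ => h.2 t⟩

lemma LiftOn.mono {g : ℝ → ℂ} {s t : Set ℝ} (h : LiftOn L F g s) (hst : t ⊆ s) : LiftOn L F g t :=
  ⟨h.1.mono hst, fun x hx => h.2 x (hst hx)⟩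

/-- pole chart with ball target -/
structure PC (L : AddSubgroup ℂ) (F : ℂ → ℂ) (h : OpenPartialHomeomorph ℂ ℂ) (ρ : ℝ) : Prop where
  pos : 0 < ρ
  zero_mem : (0 : ℂ) ∈ h.source
  zero : h 0 = 0
  target : h.target = Metric.ball 0 ρ
  prop : ∀ x ∈ h.source, x ≠ 0 → x ∉ L ∧ F x ≠ 0 ∧ h x = (F x)⁻¹

namespace Core

lemma pc (C : Core L F) : ∃ h ρ, PC L F h ρ := by
  obtain ⟨h, h1, h0, h2⟩ := C.pole
  obtain ⟨ρ, hρ, hb⟩ := restr_ball h h1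
  rw [h0] at hb
  refine ⟨h.trans (OpenPartialHomeomorph.ofSet (Metric.ball 0 ρ) Metric.isOpen_ball), ρ, hρ, ?_, ?_,
      ?_, ?_⟩
  · simp [h1, h0, hρ]
  · simp [h0]
  · ext x
    simp only [OpenPartialHomeomorph.trans_target, OpenPartialHomeomorph.ofSet_target,
        OpenPartialHomeomorph.ofSet_symm, OpenPartialHomeomorph.ofSet_apply, preimage_id,
        mem_inter_iff]
    exact ⟨fun a => a.1, fun a => ⟨a, hb a⟩⟩
  · intro x hx hx0
    have : x ∈ h.source := by
      simp only [OpenPartialHomeomorph.trans_source, mem_inter_iff] at hx; exact hx.1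
    simpa using h2 x this hx0

end Core

lemma PC.symm_zero {h : OpenPartialHomeomorph ℂ ℂ} {ρ : ℝ} (P : PC L F h ρ) : h.symm 0 = 0 := by
  have := h.left_inv P.zero_mem
  rwa [P.zero] at this

lemma PC.symm {h : OpenPartialHomeomorph ℂ ℂ} {ρ : ℝ} (P : PC L F h ρ) {y : ℂ} (hy : ‖y‖ < ρ)
    (hy0 : y ≠ 0) : h.symm y ∈ h.source ∧ h.symm y ≠ 0 ∧ h.symm y ∉ L ∧ F (h.symm y) = y⁻¹ := by
  have ht : y ∈ h.target := by rw [P.target]; simpa using hy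
  have h1 := h.map_target ht
  have h2 : h.symm y ≠ 0 := by
    intro e
    have := h.right_inv ht
    rw [e, P.zero] at this
    exact hy0 this.symm
  obtain ⟨a, b, c⟩ := P.prop _ h1 h2
  refine ⟨h1, h2, a, ?_⟩
  rw [h.right_inv ht] at c
  exact (inv_eq_iff_eq_inv.2 c).symm

lemma small_inv {ρ t : ℝ} (hρ : 0 < ρ) (ht : ρ⁻¹ < |t|) :
    ‖((t : ℂ) * I)⁻¹‖ < ρ ∧ ((t : ℂ) * I)⁻¹ ≠ 0 := by
  have : 0 < |t| := lt_trans (inv_pos.2 hρ) ht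
  constructor
  · rw [norm_inv, norm_mul, norm_I, mul_one, norm_real, Real.norm_eq_abs]
    exact inv_lt_of_inv_lt₀ hρ ht
  · simpa using this

lemma PC.branch {h : OpenPartialHomeomorph ℂ ℂ} {ρ : ℝ} (P : PC L F h ρ) :
    LiftOn L F (fun t => h.symm ((t : ℂ) * I)⁻¹) {t | ρ⁻¹ < |t|} := by
  constructor
  · intro t ht
    obtain ⟨a, b⟩ := small_inv P.pos ht
    have hc : ContinuousAt h.symm (((t : ℂ) * I)⁻¹) :=
      h.continuousAt_symm (by rw [P.target]; simpa using a)
    have : ContinuousAt (fun t : ℝ => ((t : ℂ) * I)⁻¹) t :=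
      ContinuousAt.inv₀ (by fun_prop) (by simpa using b)
    exact (ContinuousAt.comp (f := fun t : ℝ => ((t : ℂ) * I)⁻¹) hc this).continuousWithinAt
  · intro t ht
    obtain ⟨a, b⟩ := small_inv P.pos ht
    obtain ⟨-, -, c, d⟩ := P.symm a b
    exact ⟨c, by rw [d, inv_inv]⟩

namespace Core

lemma lift_unique (C : Core L F) {s : Set ℝ} (hs : IsPreconnected s) {g g' : ℝ → ℂ}
    (hg : LiftOn L F g s) (hg' : LiftOn L F g' s) {t₀ : ℝ} (ht : t₀ ∈ s) (h0 : g t₀ = g' t₀) :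
    EqOn g g' s := by
  have : PreconnectedSpace s := isPreconnected_iff_preconnectedSpace.1 hs
  have c1 := continuousOn_iff_continuous_domRestrict.1 hg.1
  have c2 := continuousOn_iff_continuous_domRestrict.1 hg'.1
  have hcl : IsClopen {x : s | s.domRestrict g x = s.domRestrict g' x} := by
    refine ⟨isClosed_eq c1 c2, ?_⟩
    rw [isOpen_iff_mem_nhds]
    intro x hx
    have hx' : g x = g' x := hx
    obtain ⟨h, h1, h2⟩ := C.reg (g x) (hg.2 x x.2).1 (by rw [(hg.2 x x.2).2]; simp)
    have n1 := c1.continuousAt.preimage_mem_nhds (x := x) (h.open_source.mem_nhds h1)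
    have n2 := c2.continuousAt.preimage_mem_nhds (x := x) (h.open_source.mem_nhds (show g' x ∈ h.source from hx' ▸ h1))
    filter_upwards [n1, n2] with y hy1 hy2
    refine h.injOn hy1 hy2 ?_
    have e1 := (h2 _ hy1).2
    have e2 := (h2 _ hy2).2
    rw [e1, e2]
    exact (hg.2 y y.2).2.trans (hg'.2 y y.2).2.symm
  have := hcl.eq_univ ⟨⟨t₀, ht⟩, h0⟩
  intro t ht
  have h3 : (⟨t, ht⟩ : s) ∈ {x : s | s.domRestrict g x = s.domRestrict g' x} := by rw [this]; trivial
  exact h3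

lemma lift_add (C : Core L F) {l : ℂ} (hl : l ∈ L) {c : ℝ}
    (hc : ∀ k ∉ L, F (k + l) = F k + c * I) {g : ℝ → ℂ} {s : Set ℝ} (hg : LiftOn L F g s) :
    LiftOn L F (fun t => g (t - c) + l) {t | t - c ∈ s} := by
  constructor
  · exact (hg.1.comp (f := fun t : ℝ => t - c) (by fun_prop) (fun t ht => ht)).add continuousOn_const
  · intro t ht
    obtain ⟨a, b⟩ := hg.2 _ ht
    refine ⟨by rwa [add_mem_iff' hl], ?_⟩
    rw [hc _ a, b]; push_cast; ring

lemma lift_neg (C : Core L F) {g : ℝ → ℂ} (hg : Lift L F g) : Lift L F (fun t => -g (-t)) := by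
  refine ⟨(hg.1.comp continuous_neg).neg, fun t => ?_⟩
  obtain ⟨a, b⟩ := hg.2 (-t)
  refine ⟨by simpa using a, ?_⟩
  rw [C.odd, b]; push_cast; ring

/-- section through `k` on an interval of radius `δ` -/
def Sec (L : AddSubgroup ℂ) (F : ℂ → ℂ) (δ : ℝ) (k : ℂ) : Prop :=
  ∃ s : ℝ → ℂ, s (F k).im = k ∧ LiftOn L F s (Ioo ((F k).im - δ) ((F k).im + δ))

lemma sec_mono {δ δ' : ℝ} (h : δ' ≤ δ) {k : ℂ} (hs : Sec L F δ k) : Sec L F δ' k := by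
  obtain ⟨s, a, b⟩ := hs
  exact ⟨s, a, b.mono (Ioo_subset_Ioo (by linarith) (by linarith))⟩

lemma sec_add (C : Core L F) {δ : ℝ} {k l : ℂ} (hl : l ∈ L) (hk : k ∉ L) (hs : Sec L F δ k) :
    Sec L F δ (k + l) := by
  obtain ⟨s, a, b⟩ := hs
  obtain ⟨c, hc⟩ := C.per l hl
  have e : (F (k + l)).im = (F k).im + c := by rw [hc k hk]; simp
  refine ⟨fun t => s (t - c) + l, ?_, (C.lift_add hl hc b).mono ?_⟩
  · rw [e]; simp [a]
  · rintro t ⟨h1, h2⟩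
    rw [e] at h1 h2
    exact ⟨by linarith, by linarith⟩

lemma sec_uniform (C : Core L F) :
    ∃ δ > 0, ∀ k ∉ L, (F k).re = 0 → Sec L F δ k := by
  obtain ⟨K, hK, hKL⟩ := C.cpt
  suffices H : ∃ δ > 0, ∀ k ∈ K, k ∉ L → (F k).re = 0 → Sec L F δ k by
    obtain ⟨δ, hδ, H⟩ := H
    refine ⟨δ, hδ, fun k hk h0 => ?_⟩
    obtain ⟨l, hl, hkl⟩ := hKL k
    have hk' : k + l ∉ L := by rwa [add_mem_iff' hl]
    have := C.sec_add (L.neg_mem hl) hk' (H (k + l) hkl hk' (by rw [C.re_per hl hk, h0]))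
    simpa using this
  refine hK.induction_on (p := fun S => ∃ δ > 0, ∀ k ∈ S, k ∉ L → (F k).re = 0 → Sec L F δ k)
    ⟨1, one_pos, by simp⟩ ?_ ?_ ?_
  · rintro s t hst ⟨δ, hδ, H⟩
    exact ⟨δ, hδ, fun k hk => H k (hst hk)⟩
  · rintro s t ⟨δ, hδ, H⟩ ⟨δ', hδ', H'⟩
    refine ⟨min δ δ', lt_min hδ hδ', ?_⟩
    rintro k (hk | hk) h1 h2
    · exact sec_mono (min_le_left _ _) (H k hk h1 h2)
    · exact sec_mono (min_le_right _ _) (H' k hk h1 h2)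
  intro z hz
  suffices H : ∃ t ∈ 𝓝 z, ∃ δ > 0, ∀ k ∈ t, k ∉ L → (F k).re = 0 → Sec L F δ k by
    obtain ⟨t, ht, H⟩ := H
    exact ⟨t, mem_nhdsWithin_of_mem_nhds ht, H⟩
  have im_eq : ∀ {w : ℂ}, w.re = 0 → w = (w.im : ℂ) * I := by
    intro w hw; apply Complex.ext <;> simp [hw]
  by_cases hzL : z ∈ L
  · obtain ⟨h, ρ, P⟩ := C.pc
    have hρ' : 0 < ρ⁻¹ + 1 := by have := P.pos; positivity
    obtain ⟨c, hc⟩ := C.per z hzL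
    have hn : h.source ∩ h ⁻¹' Metric.ball 0 (ρ⁻¹ + 1)⁻¹ ∈ 𝓝 (0 : ℂ) := by
      refine inter_mem (h.open_source.mem_nhds P.zero_mem) ?_
      refine (h.continuousAt P.zero_mem).preimage_mem_nhds ?_
      rw [P.zero]; exact Metric.ball_mem_nhds _ (inv_pos.2 hρ')
    have hcz : Tendsto (fun k => k - z) (𝓝 z) (𝓝 0) := by
      have : Tendsto (fun k => k - z) (𝓝 z) (𝓝 (z - z)) := Continuous.tendsto (by fun_prop) z
      simpa using this
    refine ⟨_, hcz hn, 1, one_pos, ?_⟩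
    rintro k ⟨hk1, hk2⟩ hkL hk0
    have hkz : k - z ∉ L := by rw [sub_eq_add_neg, add_mem_iff' (L.neg_mem hzL)]; exact hkL
    have hkz0 : k - z ≠ 0 := fun e => hkz (e ▸ L.zero_mem)
    obtain ⟨-, a, b⟩ := P.prop _ hk1 hkz0
    have ek : F k = F (k - z) + c * I := by rw [← hc _ hkz]; simp
    have hre : (F (k - z)).re = 0 := by rw [ek] at hk0; simpa using hk0
    have him : (F k).im = (F (k - z)).im + c := by rw [ek]; simp
    have hbig : ρ⁻¹ + 1 < |(F (k - z)).im| := by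
      rw [mem_preimage, mem_ball_zero_iff, b, norm_inv, im_eq hre, norm_mul, norm_I, mul_one,
        norm_real, Real.norm_eq_abs] at hk2
      refine (inv_lt_inv₀ ?_ hρ').1 hk2
      rw [abs_pos]; intro e; exact a (Complex.ext hre e)
    refine ⟨_, ?_, (C.lift_add hzL hc P.branch).mono ?_⟩
    · rw [him]
      show h.symm ((((F (k - z)).im + c - c : ℝ) : ℂ) * I)⁻¹ + z = k
      rw [add_sub_cancel_right, ← im_eq hre, ← b, h.left_inv hk1]; simp
    · rintro t ⟨h1, h2⟩
      rw [him] at h1 h2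
      show ρ⁻¹ < |t - c|
      have : |(F (k - z)).im - (t - c)| < 1 := by rw [abs_lt]; constructor <;> linarith
      have := abs_sub_abs_le_abs_sub (F (k - z)).im (t - c)
      linarith
  by_cases hz0 : (F z).re = 0
  · obtain ⟨h, h1, h2⟩ := C.reg z hzL hz0
    obtain ⟨ρ, hρ, hb⟩ := restr_ball h h1
    refine ⟨h.source ∩ h ⁻¹' Metric.ball (h z) (ρ / 2), ?_, ρ / 2, by positivity, ?_⟩
    · exact inter_mem (h.open_source.mem_nhds h1)
        ((h.continuousAt h1).preimage_mem_nhds (Metric.ball_mem_nhds _ (by positivity)))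
    rintro k ⟨hk1, hk2⟩ hkL hk0
    have hk := im_eq hk0
    have key : ∀ t ∈ Ioo ((F k).im - ρ / 2) ((F k).im + ρ / 2), (t : ℂ) * I ∈ h.target := by
      rintro t ⟨ht1, ht2⟩
      apply hb
      rw [Metric.mem_ball]
      have e : dist ((t : ℂ) * I) (h k) < ρ / 2 := by
        rw [(h2 k hk1).2, hk, dist_eq, ← sub_mul, norm_mul, norm_I, mul_one, ← ofReal_sub,
          norm_real, Real.norm_eq_abs, abs_lt]
        constructor <;> linarith
      have := dist_triangle ((t : ℂ) * I) (h k) (h z)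
      have h3 : dist (h k) (h z) < ρ / 2 := hk2
      linarith
    refine ⟨fun t => h.symm (t * I), ?_, ?_, ?_⟩
    · simp only; rw [← hk, ← (h2 k hk1).2, h.left_inv hk1]
    · exact h.continuousOn_symm.comp (by fun_prop) key
    · intro t ht
      obtain ⟨a, b⟩ := h2 _ (h.map_target (key t ht))
      exact ⟨a, by rw [← b, h.right_inv (key t ht)]⟩
  · refine ⟨(Zt L F)ᶜ, C.isClosed_Zt.isOpen_compl.mem_nhds (by simp [Zt, hzL, hz0]), 1, one_pos, ?_⟩
    intro k hk _ h0
    exact absurd (Or.inr h0) hk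

lemma glue (C : Core L F) {U V : Set ℝ} (hU : IsOpen U) (hV : IsOpen V) (hUV : IsPreconnected (U ∩ V))
    {g g' : ℝ → ℂ} (hg : LiftOn L F g U) (hg' : LiftOn L F g' V) {t₀ : ℝ} (h1 : t₀ ∈ U) (h2 : t₀ ∈ V)
    (he : g t₀ = g' t₀) : ∃ f, EqOn f g U ∧ LiftOn L F f (U ∪ V) := by
  classical
  have hu := C.lift_unique hUV (hg.mono inter_subset_left) (hg'.mono inter_subset_right) ⟨h1, h2⟩ he
  have e1 : EqOn (fun t => if t ∈ U then g t else g' t) g U := fun t ht => by simp [ht]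
  have e2 : EqOn (fun t => if t ∈ U then g t else g' t) g' V := fun t ht => by
    by_cases h : t ∈ U
    · simp [h, hu ⟨h, ht⟩]
    · simp [h]
  refine ⟨_, e1, ?_, ?_⟩
  · exact (hg.1.congr e1).union_of_isOpen (hg'.1.congr e2) hU hV
  · rintro t (ht | ht)
    · rw [e1 ht]; exact hg.2 t ht
    · rw [e2 ht]; exact hg'.2 t ht

lemma lift_exists (C : Core L F) {k : ℂ} (hk : k ∉ L) (h0 : (F k).re = 0) :
    ∃ g, Lift L F g ∧ g (F k).im = k := by
  obtain ⟨δ, hδ, H⟩ := C.sec_uniform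
  set v := (F k).im with hv
  have step : ∀ n : ℕ, ∃ g, g v = k ∧ LiftOn L F g (Ioo (v - (n + 1) * (δ / 2)) (v + (n + 1) * (δ / 2))) := by
    intro n
    induction n with
    | zero =>
      obtain ⟨s, a, b⟩ := H k hk h0
      exact ⟨s, a, b.mono (Ioo_subset_Ioo (by rw [← hv]; norm_num; linarith) (by rw [← hv]; norm_num; linarith))⟩
    | succ n ih =>
      obtain ⟨g, g1, g2⟩ := ih
      set r : ℝ := (n + 1) * (δ / 2) with hr
      have hrp : δ / 2 ≤ r := by rw [hr]; nlinarith [Nat.cast_nonneg (α := ℝ) n]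
      have hvm : v ∈ Ioo (v - r) (v + r) := ⟨by linarith, by linarith⟩
      have sec : ∀ t ∈ Ioo (v - r) (v + r), ∃ s : ℝ → ℂ, s t = g t ∧ LiftOn L F s (Ioo (t - δ) (t + δ)) := by
        intro t ht
        obtain ⟨a, b⟩ := g2.2 t ht
        obtain ⟨s, c, d⟩ := H (g t) a (by rw [b]; simp)
        have e : (F (g t)).im = t := by rw [b]; simp
        rw [e] at c d
        exact ⟨s, c, d⟩
      have m1 : v + r - δ / 4 ∈ Ioo (v - r) (v + r) := ⟨by linarith, by linarith⟩
      have m2 : v - r + δ / 4 ∈ Ioo (v - r) (v + r) := ⟨by linarith, by linarith⟩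
      obtain ⟨s, s1, s2⟩ := sec _ m1
      obtain ⟨s', s1', s2'⟩ := sec _ m2
      obtain ⟨f, f1, f2⟩ := C.glue isOpen_Ioo isOpen_Ioo (by
        exact (ordConnected_Ioo.inter ordConnected_Ioo).isPreconnected) g2 s2 m1 ⟨by linarith, by linarith⟩ s1.symm
      have f2' : LiftOn L F f (Ioo (v - r) (v + r + δ / 2)) := f2.mono (by
        rintro t ⟨a, b⟩
        by_cases h : t < v + r
        · exact Or.inl ⟨a, h⟩
        · exact Or.inr ⟨by linarith, by linarith⟩)
      obtain ⟨f', f1', f3⟩ := C.glue isOpen_Ioo isOpen_Ioo (by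
        exact (ordConnected_Ioo.inter ordConnected_Ioo).isPreconnected) f2' s2'
        (t₀ := v - r + δ / 4) ⟨by linarith, by linarith⟩ ⟨by linarith, by linarith⟩
        (by rw [f1 m2, s1'])
      refine ⟨f', ?_, f3.mono ?_⟩
      · rw [f1' ⟨hvm.1, by linarith⟩, f1 hvm, g1]
      · rintro t ⟨a, b⟩
        have e : ((n + 1 : ℕ) + 1 : ℝ) * (δ / 2) = r + δ / 2 := by rw [hr]; push_cast; ring
        rw [e] at a b
        by_cases h : v - r < t
        · exact Or.inl ⟨h, by linarith⟩
        · exact Or.inr ⟨by linarith, by linarith⟩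
  choose g g1 g2 using step
  have hex : ∀ t : ℝ, ∃ n : ℕ, t ∈ Ioo (v - (n + 1) * (δ / 2)) (v + (n + 1) * (δ / 2)) := by
    intro t
    obtain ⟨n, hn⟩ := exists_nat_gt (|t - v| / (δ / 2))
    refine ⟨n, ?_⟩
    rw [div_lt_iff₀ (by positivity)] at hn
    have h1 := abs_lt.1 hn
    exact ⟨by nlinarith, by nlinarith⟩
  choose N hN using hex
  have agree : ∀ n m : ℕ, ∀ t, t ∈ Ioo (v - (n + 1) * (δ / 2)) (v + (n + 1) * (δ / 2)) →
      t ∈ Ioo (v - (m + 1) * (δ / 2)) (v + (m + 1) * (δ / 2)) → g n t = g m t := by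
    intro n m t h1 h2
    have hp : ∀ n : ℕ, 0 < ((n : ℝ) + 1) * (δ / 2) := fun n => by positivity
    refine C.lift_unique (s := Ioo _ _ ∩ Ioo _ _) (ordConnected_Ioo.inter ordConnected_Ioo).isPreconnected
      ((g2 n).mono inter_subset_left) ((g2 m).mono inter_subset_right) (t₀ := v) ?_ ?_ ⟨h1, h2⟩
    · have := hp n; have := hp m
      exact ⟨⟨by linarith, by linarith⟩, ⟨by linarith, by linarith⟩⟩
    · rw [g1, g1]
  refine ⟨fun t => g (N t) t, ⟨?_, fun t => (g2 (N t)).2 t (hN t)⟩, g1 _⟩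
  rw [continuous_iff_continuousAt]
  intro t
  have hnh := isOpen_Ioo.mem_nhds (hN t)
  refine ((g2 (N t)).1.continuousAt hnh).congr ?_
  filter_upwards [hnh] with y hy
  exact agree _ _ _ hy (hN y)

end Core
end ZU

namespace ZU
open Topology
variable {L : AddSubgroup ℂ} {F : ℂ → ℂ}

namespace Core

lemma lift_eq (C : Core L F) {g g' : ℝ → ℂ} (hg : Lift L F g) (hg' : Lift L F g') {t : ℝ}
    (h : g t = g' t) : g = g' := by
  funext x
  exact C.lift_unique isPreconnected_univ (hg.on univ) (hg'.on univ) (mem_univ t) h (mem_univ x)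

lemma lift_mem_Zt {g : ℝ → ℂ} (hg : Lift L F g) (t : ℝ) : g t ∈ Zt L F := by
  refine Or.inr ?_
  rw [(hg.2 t).2]; simp

lemma lift_F_im {g : ℝ → ℂ} (hg : Lift L F g) (t : ℝ) : (F (g t)).im = t := by
  rw [(hg.2 t).2]; simp

lemma lift_inj {g : ℝ → ℂ} (hg : Lift L F g) {s t : ℝ} (h : g s = g t) : s = t := by
  rw [← lift_F_im hg s, h, lift_F_im hg t]

lemma lift_meet (C : Core L F) {g g' : ℝ → ℂ} (hg : Lift L F g) (hg' : Lift L F g') {s t : ℝ}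
    {l : ℂ} (hl : l ∈ L) (h : g t = g' s + l) (x : ℝ) : g (t + x) = g' (s + x) + l := by
  obtain ⟨c, hc⟩ := C.per l hl
  have h1 : Lift L F (fun t => g' (t - c) + l) := by
    have := C.lift_add hl hc (hg'.on univ)
    exact ⟨by simpa [continuousOn_univ] using this.1, fun t => this.2 t trivial⟩
  have e := lift_F_im hg t
  rw [h, hc _ (hg'.2 s).1, (hg'.2 s).2] at e
  have e' : s + c = t := by simpa using e
  have := C.lift_eq hg h1 (t := t) (by rw [h, ← e']; simp)
  rw [this]; simp only
  congr 2; linarith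

/-- A zero near a regular point lies on the lift through it. -/
lemma near_lift (C : Core L F) {G : ℝ → ℂ} (hG : Lift L F G) (v : ℝ) :
    ∀ᶠ y in 𝓝 (G v), y ∈ Zt L F → y = G (F y).im := by
  obtain ⟨h, h1, h2⟩ := C.reg (G v) (hG.2 v).1 (by rw [(hG.2 v).2]; simp)
  have n1 : ∀ᶠ y in 𝓝 (G v), y ∈ h.source := h.open_source.mem_nhds h1
  have n2 : ∀ᶠ t in 𝓝 v, G t ∈ h.source := hG.1.continuousAt.preimage_mem_nhds (h.open_source.mem_nhds h1)
  have n3 : Tendsto (fun y => (F y).im) (𝓝 (G v)) (𝓝 v) := by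
    have := continuous_im.continuousAt.comp (C.cont (G v) (hG.2 v).1)
    unfold ContinuousAt at this
    simp only [Function.comp_def] at this
    rwa [lift_F_im hG] at this
  filter_upwards [n1, n3.eventually n2] with y hy1 hy2 hyZ
  refine h.injOn hy1 hy2 ?_
  rw [(h2 _ hy1).2, (h2 _ hy2).2, (hG.2 _).2]
  have hre : (F y).re = 0 := by
    rcases hyZ with hz | hz
    · exact absurd hz (h2 _ hy1).1
    · exact hz
  apply Complex.ext <;> simp [hre]

lemma near_pole (C : Core L F) {h : OpenPartialHomeomorph ℂ ℂ} {ρ : ℝ} (P : PC L F h ρ) {x : ℂ}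
    {t : ℝ} (hx : x ∈ h.source) (hx0 : x ≠ 0) (hF : F x = t * I) :
    ρ⁻¹ < |t| ∧ x = h.symm ((t : ℂ) * I)⁻¹ := by
  obtain ⟨-, a, b⟩ := P.prop x hx hx0
  have h1 := h.map_source hx
  rw [P.target, mem_ball_zero_iff, b, norm_inv, hF, norm_mul, norm_I, mul_one, norm_real,
    Real.norm_eq_abs] at h1
  refine ⟨?_, by rw [← hF, ← b, h.left_inv hx]⟩
  refine inv_lt_of_inv_lt₀ ?_ h1
  rw [abs_pos]; rintro rfl
  simp [hF] at a

/-- the lift emanating from the pole -/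
structure IsG0 (L : AddSubgroup ℂ) (F : ℂ → ℂ) (h : OpenPartialHomeomorph ℂ ℂ) (ρ : ℝ)
    (g : ℝ → ℂ) : Prop where
  lift : Lift L F g
  eq : ∀ t < -ρ⁻¹, g t = h.symm ((t : ℂ) * I)⁻¹
  lim : Tendsto g atBot (𝓝 0)
  eq' : ∀ t, ρ⁻¹ < t → -g (-t) = h.symm ((t : ℂ) * I)⁻¹

lemma g0_exists (C : Core L F) {h : OpenPartialHomeomorph ℂ ℂ} {ρ : ℝ} (P : PC L F h ρ) :
    ∃ g, IsG0 L F h ρ g := by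
  have hR : 0 < ρ⁻¹ := inv_pos.2 P.pos
  have hb := P.branch
  have hm : -(ρ⁻¹ + 1) ∈ {t : ℝ | ρ⁻¹ < |t|} := by
    show ρ⁻¹ < |-(ρ⁻¹ + 1)|
    rw [abs_neg, abs_of_pos (by linarith)]; linarith
  obtain ⟨b1, b2⟩ := hb.2 _ hm
  obtain ⟨g, hg, e⟩ := C.lift_exists b1 (by rw [b2]; simp)
  rw [b2] at e
  have e' : g (-(ρ⁻¹ + 1)) = h.symm (((-(ρ⁻¹ + 1) : ℝ) : ℂ) * I)⁻¹ := by
    refine Eq.trans ?_ e; congr 1; simp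
  have heq : ∀ t < -ρ⁻¹, g t = h.symm ((t : ℂ) * I)⁻¹ := by
    intro t ht
    refine C.lift_unique (s := Iio (-ρ⁻¹)) isPreconnected_Iio (hg.on _) (hb.mono ?_)
      (t₀ := -(ρ⁻¹ + 1)) (by simp) e' ht
    intro x hx
    have : x < -ρ⁻¹ := hx
    show ρ⁻¹ < |x|
    rw [abs_of_neg (by linarith)]; linarith
  have lim : Tendsto g atBot (𝓝 0) := by
    have h1 : Tendsto (fun t : ℝ => ((t : ℂ) * I)⁻¹) atBot (𝓝 0) := by
      refine tendsto_inv₀_cobounded.comp ?_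
      rw [← tendsto_norm_atTop_iff_cobounded]
      simpa using tendsto_abs_atBot_atTop
    have h2 : Tendsto h.symm (𝓝 0) (𝓝 0) := by
      have := h.continuousAt_symm (x := 0) (by rw [P.target]; simpa using P.pos)
      unfold ContinuousAt at this
      rwa [P.symm_zero] at this
    refine (h2.comp h1).congr' ?_
    filter_upwards [Iio_mem_atBot (-ρ⁻¹)] with t ht
    exact (heq t ht).symm
  refine ⟨g, hg, heq, lim, ?_⟩
  have hn : Tendsto (fun t => -g (-t)) atTop (𝓝 0) := by
    have := (lim.comp tendsto_neg_atTop_atBot).neg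
    simpa using this
  obtain ⟨t, ht1, ht2⟩ := ((hn.eventually (h.open_source.mem_nhds P.zero_mem)).and
    (Ioi_mem_atTop ρ⁻¹)).exists
  have hneg := C.lift_neg hg
  have hne : -g (-t) ≠ 0 := fun e => (hneg.2 t).1 (by simp only; rw [e]; exact L.zero_mem)
  have := (C.near_pole P ht1 hne (hneg.2 t).2).2
  intro s hs
  refine C.lift_unique (s := Ioi ρ⁻¹) isPreconnected_Ioi (hneg.on _) (hb.mono ?_) (t₀ := t) ht2
    this hs
  intro x hx
  have : ρ⁻¹ < x := hx
  exact lt_of_lt_of_le this (le_abs_self x)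

/-- points of the zero set near a lattice point -/
lemma near_lat (C : Core L F) {h : OpenPartialHomeomorph ℂ ℂ} {ρ : ℝ} (P : PC L F h ρ) {g₀ : ℝ → ℂ}
    (G : IsG0 L F h ρ g₀) {y l : ℂ} (hl : l ∈ L) (hy : y ∉ L) (hre : (F y).re = 0)
    (hyl : y - l ∈ h.source) : ∃ s < -ρ⁻¹, y = g₀ s + l ∨ y = -g₀ s + l := by
  have hyl' : y - l ∉ L := by rw [sub_eq_add_neg, add_mem_iff' (L.neg_mem hl)]; exact hy
  have hre' : (F (y - l)).re = 0 := by rw [sub_eq_add_neg, C.re_per (L.neg_mem hl) hy, hre]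
  have hF : F (y - l) = ((F (y - l)).im : ℝ) * I := by apply Complex.ext <;> simp [hre']
  obtain ⟨a, b⟩ := C.near_pole P hyl (fun e => hyl' (e ▸ L.zero_mem)) hF
  rcases lt_abs.1 a with a | a
  · refine ⟨-(F (y - l)).im, by linarith, Or.inr ?_⟩
    rw [G.eq' _ a, ← b]; ring
  · refine ⟨(F (y - l)).im, by linarith, Or.inl ?_⟩
    rw [G.eq _ (by linarith), ← b]; ring

/-- a lift either touches the polar neighbourhood at a later time or is periodic -/
lemma dichotomy (C : Core L F) {h : OpenPartialHomeomorph ℂ ℂ} {ρ : ℝ} (P : PC L F h ρ)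
    {g : ℝ → ℂ} (hg : Lift L F g) (t₁ : ℝ) :
    (∃ t ≥ t₁, ∃ l ∈ L, g t - l ∈ h.source) ∨ ∃ T > 0, ∃ l ∈ L, ∀ t, g (t + T) = g t + l := by
  by_contra hcon
  push Not at hcon
  obtain ⟨hno, hper⟩ := hcon
  obtain ⟨K, hK, hKL⟩ := C.cpt
  choose ℓ hℓ hℓK using fun n : ℕ => hKL (g (t₁ + n))
  obtain ⟨x, hx, φ, hφ, hlim⟩ := (hK.inter_right C.isClosed_Zt).tendsto_subseq
    (x := fun n : ℕ => g (t₁ + n) + ℓ n) (fun n => ⟨hℓK n, (C.Zt_add (hℓ n)).2 (lift_mem_Zt hg _)⟩)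
  have hxL : x ∉ L := by
    intro hxL
    have : Tendsto (fun n => g (t₁ + φ n) + ℓ (φ n) - x) atTop (𝓝 0) := by
      simpa using hlim.sub_const x
    obtain ⟨n, hn⟩ := (this.eventually (h.open_source.mem_nhds P.zero_mem)).exists
    refine hno (t₁ + φ n) (by simp) (x - ℓ (φ n)) (L.sub_mem hxL (hℓ _)) ?_
    rwa [show g (t₁ + φ n) - (x - ℓ (φ n)) = g (t₁ + φ n) + ℓ (φ n) - x by ring]
  have hx0 : (F x).re = 0 := hx.2.resolve_left hxL
  obtain ⟨G, hG, hGx⟩ := C.lift_exists hxL hx0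
  have n1 := C.near_lift hG (F x).im
  rw [hGx] at n1
  have hv : Tendsto (fun n => (F (g (t₁ + φ n) + ℓ (φ n))).im) atTop (𝓝 (F x).im) :=
    (continuous_im.continuousAt.comp (C.cont x hxL)).tendsto.comp hlim
  have n2 := hv.eventually (Metric.ball_mem_nhds _ (show (0 : ℝ) < 1 / 2 by norm_num))
  obtain ⟨N, hN⟩ := eventually_atTop.1 ((hlim.eventually n1).and n2)
  obtain ⟨a1, a2⟩ := hN N le_rfl
  obtain ⟨b1, b2⟩ := hN (N + 1) (by omega)
  have a1 := a1 ((C.Zt_add (hℓ _)).2 (lift_mem_Zt hg _))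
  have b1 := b1 ((C.Zt_add (hℓ _)).2 (lift_mem_Zt hg _))
  simp only [Function.comp_apply] at a1 b1
  set p := (F (g (t₁ + φ N) + ℓ (φ N))).im with hp
  set q := (F (g (t₁ + φ (N + 1)) + ℓ (φ (N + 1)))).im with hq
  have hlt : φ N + 1 ≤ φ (N + 1) := hφ (Nat.lt_succ_self N)
  have hlt' : (φ N : ℝ) + 1 ≤ φ (N + 1) := by exact_mod_cast hlt
  have ha := C.lift_meet hg hG (L.neg_mem (hℓ (φ N))) (t := t₁ + φ N) (s := p) (by rw [← a1]; ring)
  have hb := C.lift_meet hg hG (L.neg_mem (hℓ (φ (N + 1)))) (t := t₁ + φ (N + 1)) (s := q)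
    (by rw [← b1]; ring)
  have a2' : |p - (F x).im| < 1 / 2 := a2
  have b2' : |q - (F x).im| < 1 / 2 := b2
  rw [abs_lt] at a2' b2'
  obtain ⟨t, ht⟩ := hper (φ (N + 1) - φ N - (q - p)) (by linarith) (ℓ (φ N) - ℓ (φ (N + 1)))
    (L.sub_mem (hℓ _) (hℓ _))
  apply ht
  have e1 := ha (t - t₁ - φ N)
  have e2 := hb (t - t₁ - φ N - (q - p))
  rw [show t₁ + φ N + (t - t₁ - φ N) = t by ring] at e1
  rw [show t₁ + φ (N + 1) + (t - t₁ - φ N - (q - p)) = t + (φ (N + 1) - φ N - (q - p)) by ring,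
    show q + (t - t₁ - φ N - (q - p)) = p + (t - t₁ - φ N) by ring] at e2
  rw [e1, e2]; ring

lemma g0_inj (C : Core L F) {h : OpenPartialHomeomorph ℂ ℂ} {ρ : ℝ} {g₀ : ℝ → ℂ}
    (G : IsG0 L F h ρ g₀) {s t : ℝ} {l : ℂ} (hl : l ∈ L) (e : g₀ t = g₀ s + l) : l = 0 ∧ t = s := by
  have hm := C.lift_meet G.lift G.lift hl e
  have l1 : Tendsto (fun x => g₀ (t + x)) atBot (𝓝 0) :=
    G.lim.comp (tendsto_atBot_add_const_left _ _ tendsto_id)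
  have l2 : Tendsto (fun x => g₀ (s + x) + l) atBot (𝓝 (0 + l)) :=
    (G.lim.comp (tendsto_atBot_add_const_left _ _ tendsto_id)).add_const l
  have := tendsto_nhds_unique (l1.congr hm) l2
  have hl0 : l = 0 := by simpa using this.symm
  refine ⟨hl0, lift_inj G.lift ?_⟩
  rw [e, hl0, add_zero]

lemma g0_sym (C : Core L F) {h : OpenPartialHomeomorph ℂ ℂ} {ρ : ℝ} (P : PC L F h ρ) {g₀ : ℝ → ℂ}
    (G : IsG0 L F h ρ g₀) : ∃ ℓ ∈ L, ∃ c : ℝ, ℓ ≠ 0 ∧ (∀ s, g₀ s = -g₀ (c - s) + ℓ) ∧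
      2 * g₀ (c / 2) = ℓ ∧ Tendsto g₀ atTop (𝓝 ℓ) := by
  have hR : 0 < ρ⁻¹ := inv_pos.2 P.pos
  have key : ∃ ℓ ∈ L, ∃ c : ℝ, ∀ s, g₀ s = -g₀ (c - s) + ℓ := by
    rcases C.dichotomy P G.lift 0 with ⟨t, ht, l, hl, htl⟩ | ⟨T, hT, l, hl, hp⟩
    · obtain ⟨s, hs, e | e⟩ := C.near_lat P G hl (G.lift.2 t).1 (by rw [(G.lift.2 t).2]; simp) htl
      · have := (C.g0_inj G hl e).2
        linarith
      · have := C.lift_meet G.lift (C.lift_neg G.lift) hl (t := t) (s := -s) (by simpa using e)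
        refine ⟨l, hl, t + s, fun x => ?_⟩
        have e := this (x - t)
        rw [show t + (x - t) = x by ring, show -(-s + (x - t)) = t + s - x by ring] at e
        exact e
    · have := (C.g0_inj G hl (hp 0)).2
      linarith
  obtain ⟨ℓ, hℓ, c, hc⟩ := key
  have h2 : 2 * g₀ (c / 2) = ℓ := by
    have := hc (c / 2)
    rw [show c - c / 2 = c / 2 by ring] at this
    linear_combination this
  refine ⟨ℓ, hℓ, c, ?_, hc, h2, ?_⟩
  · rintro rfl
    have : g₀ (c / 2) = 0 := by simpa using h2
    exact (G.lift.2 (c / 2)).1 (this ▸ L.zero_mem)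
  · have l1 : Tendsto (fun s => -g₀ (c - s) + ℓ) atTop (𝓝 (-0 + ℓ)) := by
      refine Tendsto.add_const _ (Tendsto.neg (G.lim.comp ?_))
      exact tendsto_atBot_add_const_left _ c tendsto_neg_atTop_atBot
    simpa using l1.congr (fun s => (hc s).symm)

lemma g0_mem_cz {h : OpenPartialHomeomorph ℂ ℂ} {ρ : ℝ} {g₀ : ℝ → ℂ}
    (G : IsG0 L F h ρ g₀) {ℓ : ℂ} (hℓ : ℓ ∈ L) (hlim : Tendsto g₀ atTop (𝓝 ℓ)) :
    (∀ s, g₀ s ∈ cz L F 0) ∧ ℓ ∈ cz L F 0 := by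
  have h1 : IsPreconnected (range g₀) := isPreconnected_range G.lift.1
  have m0 : (0 : ℂ) ∈ closure (range g₀) :=
    mem_closure_of_tendsto G.lim (Eventually.of_forall fun t => mem_range_self t)
  have m1 : ℓ ∈ closure (range g₀) :=
    mem_closure_of_tendsto hlim (Eventually.of_forall fun t => mem_range_self t)
  have h2 : IsPreconnected (range g₀ ∪ {0, ℓ}) := by
    refine h1.subset_closure subset_union_left ?_
    rintro x (hx | rfl | rfl)
    · exact subset_closure hx
    · exact m0
    · exact m1
  have h3 : range g₀ ∪ {0, ℓ} ⊆ Zt L F := by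
    rintro x (⟨t, rfl⟩ | rfl | rfl)
    · exact lift_mem_Zt G.lift t
    · exact Or.inl L.zero_mem
    · exact Or.inl hℓ
  have h4 := h2.subset_connectedComponentIn (x := 0) (by simp) h3
  exact ⟨fun s => h4 (Or.inl ⟨s, rfl⟩), h4 (by simp)⟩

/-- components are contained in lift-saturated sets -/
lemma cz_subset (C : Core L F) {h : OpenPartialHomeomorph ℂ ℂ} {ρ : ℝ} (P : PC L F h ρ) {g₀ : ℝ → ℂ}
    (G : IsG0 L F h ρ g₀) {Γ : Set ℂ}
    (hA : ∀ g, Lift L F g → ∀ s t, g s ∈ Γ → g t ∈ Γ)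
    (hB : ∀ l ∈ L, ∀ s, (g₀ s + l ∈ Γ ↔ l ∈ Γ) ∧ (-g₀ s + l ∈ Γ ↔ l ∈ Γ))
    {x : ℂ} (hxZ : x ∈ Zt L F) (hx : x ∈ Γ) : cz L F x ⊆ Γ := by
  have loc : ∀ z ∈ Zt L F, ∀ᶠ y in 𝓝 z, y ∈ Zt L F → (y ∈ Γ ↔ z ∈ Γ) := by
    intro z hz
    by_cases hzL : z ∈ L
    · have hcz : Tendsto (fun k => k - z) (𝓝 z) (𝓝 0) := by
        have : Tendsto (fun k => k - z) (𝓝 z) (𝓝 (z - z)) := Continuous.tendsto (by fun_prop) z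
        simpa using this
      filter_upwards [hcz (h.open_source.mem_nhds P.zero_mem)] with y hy hyZ
      have hy' : y - z ∈ h.source := hy
      by_cases hyL : y ∈ L
      · have : y - z = 0 := by
          by_contra hne
          exact (P.prop _ hy' hne).1 (L.sub_mem hyL hzL)
        rw [sub_eq_zero.1 this]
      · obtain ⟨s, -, e | e⟩ := C.near_lat P G hzL hyL (hyZ.resolve_left hyL) hy'
        · rw [e]; exact (hB z hzL s).1
        · rw [e]; exact (hB z hzL s).2
    · obtain ⟨g, hg, e⟩ := C.lift_exists hzL (hz.resolve_left hzL)
      have := C.near_lift hg (F z).im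
      rw [e] at this
      filter_upwards [this] with y hy hyZ
      rw [hy hyZ]
      constructor
      · intro hh; rw [← e]; exact hA g hg _ _ hh
      · intro hh; rw [← e] at hh; exact hA g hg _ _ hh
  set T := cz L F x with hT
  have hTZ : T ⊆ Zt L F := connectedComponentIn_subset _ _
  have hTc : IsPreconnected T := isPreconnected_connectedComponentIn
  have : PreconnectedSpace T := isPreconnected_iff_preconnectedSpace.1 hTc
  have key : ∀ Γ' : Set ℂ, (∀ z ∈ Zt L F, ∀ᶠ y in 𝓝 z, y ∈ Zt L F → (y ∈ Γ' ↔ z ∈ Γ')) →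
      IsOpen {y : T | (y : ℂ) ∈ Γ'} := by
    intro Γ' hΓ
    rw [isOpen_iff_mem_nhds]
    intro z hz
    have := continuous_subtype_val.continuousAt.eventually (hΓ z (hTZ z.2))
    filter_upwards [this] with y hy
    exact (hy (hTZ y.2)).2 hz
  have hcl : IsClopen {y : T | (y : ℂ) ∈ Γ} := by
    refine ⟨⟨?_⟩, key Γ loc⟩
    exact key Γᶜ (fun z hz => by
      filter_upwards [loc z hz] with y hy hyZ
      simp only [mem_compl_iff, hy hyZ])
  have hxT : x ∈ T := mem_connectedComponentIn hxZ
  have := hcl.eq_univ ⟨⟨x, hxT⟩, hx⟩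
  intro y hy
  have h3 : (⟨y, hy⟩ : T) ∈ {y : T | (y : ℂ) ∈ Γ} := by rw [this]; trivial
  exact h3

end Core
end ZU

namespace ZU
open Topology
variable {L : AddSubgroup ℂ} {F : ℂ → ℂ}

/-- lifted simple closed curve with period `ℓ` filling `S` -/
structure IsCurve (L : AddSubgroup ℂ) (S : Set ℂ) (ℓ : ℂ) (p : ℝ → ℂ) : Prop where
  cont : Continuous p
  shift : ∀ t, p (t + 1) = p t + ℓ
  inj : ∀ s ∈ Ico (0 : ℝ) 1, ∀ t ∈ Ico (0 : ℝ) 1, p s - p t ∈ L → s = t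
  mem : ∀ t, p t ∈ S
  sub : S ⊆ range p

lemma IsCurve.shift_int {S : Set ℂ} {ℓ : ℂ} {p : ℝ → ℂ} (h : IsCurve L S ℓ p) (n : ℤ) :
    ∀ t, p (t + n) = p t + n * ℓ := by
  induction n using Int.induction_on with
  | zero => simp
  | succ i ih =>
    intro t
    have := h.shift (t + i)
    have e := ih t
    push_cast at e ⊢
    rw [← add_assoc, this, e]; ring
  | pred i ih =>
    intro t
    have := h.shift (t + (-i - 1 : ℤ))
    have e := ih t
    rw [show t + ((-(i : ℤ) - 1 : ℤ) : ℝ) + 1 = t + (-(i : ℤ) : ℤ) by push_cast; ring, e] at this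
    push_cast at this ⊢
    linear_combination -this

lemma zmul_mem {l : ℂ} (hl : l ∈ L) (n : ℤ) : (n : ℂ) * l ∈ L := by
  simpa using L.zsmul_mem hl n

/-- extending a path by quasi-periodicity -/
lemma ext_path {q : ℝ → ℂ} {ℓ : ℂ} (hq : ContinuousOn q (Icc 0 1)) (h0 : q 0 = 0) (h1 : q 1 = ℓ) :
    Continuous (fun t : ℝ => q (Int.fract t) + ⌊t⌋ * ℓ) := by
  have : Continuous ((fun u : ℝ => q u - u * ℓ) ∘ Int.fract) := by
    refine ContinuousOn.comp_fract'' (hq.sub (by fun_prop)) ?_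
    simp [h0, h1]
  have h2 : Continuous (fun t : ℝ => ((fun u : ℝ => q u - u * ℓ) ∘ Int.fract) t + t * ℓ) := by fun_prop
  refine h2.congr fun t => ?_
  simp only [Function.comp_apply]
  have e : (t : ℂ) = (⌊t⌋ : ℂ) + (Int.fract t : ℝ) := by
    have := Int.floor_add_fract t
    exact_mod_cast this.symm
  linear_combination e * ℓ

lemma tan_path {g : ℝ → ℂ} {ℓ : ℂ} (hg : Continuous g) (hb : Tendsto g atBot (𝓝 0))
    (ht : Tendsto g atTop (𝓝 ℓ)) : ∃ q : ℝ → ℂ, ContinuousOn q (Icc 0 1) ∧ q 0 = 0 ∧ q 1 = ℓ ∧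
      ∀ u ∈ Ioo (0 : ℝ) 1, q u = g (Real.tan (Real.pi * (u - 1 / 2))) := by
  have hpi := Real.pi_pos
  set f : ℝ → ℂ := fun u => g (Real.tan (Real.pi * (u - 1 / 2))) with hf
  have fc : ContinuousOn f (Ioo 0 1) := by
    refine hg.comp_continuousOn ?_
    refine Real.continuousOn_tan_Ioo.comp (by fun_prop) ?_
    rintro u ⟨h1, h2⟩
    exact ⟨by nlinarith, by nlinarith⟩
  have f0 : Tendsto f (𝓝[>] 0) (𝓝 0) := by
    refine hb.comp (Real.tendsto_tan_neg_pi_div_two.comp ?_)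
    refine tendsto_nhdsWithin_iff.2 ⟨?_, ?_⟩
    · have : Tendsto (fun u : ℝ => Real.pi * (u - 1 / 2)) (𝓝 0) (𝓝 (Real.pi * (0 - 1 / 2))) :=
        Continuous.tendsto (by fun_prop) 0
      rw [show Real.pi * (0 - 1 / 2) = -(Real.pi / 2) by ring] at this
      exact this.mono_left nhdsWithin_le_nhds
    · filter_upwards [self_mem_nhdsWithin] with u hu
      have : 0 < u := hu
      show -(Real.pi / 2) < _
      nlinarith
  have f1 : Tendsto f (𝓝[<] 1) (𝓝 ℓ) := by
    refine ht.comp (Real.tendsto_tan_pi_div_two.comp ?_)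
    refine tendsto_nhdsWithin_iff.2 ⟨?_, ?_⟩
    · have : Tendsto (fun u : ℝ => Real.pi * (u - 1 / 2)) (𝓝 1) (𝓝 (Real.pi * (1 - 1 / 2))) :=
        Continuous.tendsto (by fun_prop) 1
      rw [show Real.pi * (1 - 1 / 2) = Real.pi / 2 by ring] at this
      exact this.mono_left nhdsWithin_le_nhds
    · filter_upwards [self_mem_nhdsWithin] with u hu
      have : u < 1 := hu
      show _ < Real.pi / 2
      nlinarith
  refine ⟨extendFrom (Ioo 0 1) f, continuousOn_Icc_extendFrom_Ioo fc f0 f1,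
    eq_lim_at_left_extendFrom_Ioo zero_lt_one f0, eq_lim_at_right_extendFrom_Ioo zero_lt_one f1, ?_⟩
  intro u hu
  exact extendFrom_eq (subset_closure hu) ((fc u hu).tendsto)

namespace Core

lemma curve0 (C : Core L F) : ∃ ℓ ∈ L, ∃ p, ℓ ≠ 0 ∧ IsCurve L (cz L F 0) ℓ p ∧ ℓ ∈ cz L F 0 ∧
    (∀ l ∈ L, l ∈ cz L F 0 → ∃ n : ℤ, l = n * ℓ) ∧
    (∀ w, 2 * w ∈ L → w ∉ L → (∃ l ∈ L, w + l ∈ cz L F 0) → w - ℓ / 2 ∈ L) := by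
  obtain ⟨h, ρ, P⟩ := C.pc
  obtain ⟨g₀, G⟩ := C.g0_exists P
  obtain ⟨ℓ, hℓ, c, hℓ0, hsym, h2, hlim⟩ := C.g0_sym P G
  obtain ⟨hmem, hℓz⟩ := g0_mem_cz G hℓ hlim
  obtain ⟨q, qc, q0, q1, hq⟩ := tan_path G.lift.1 G.lim hlim
  have hpi := Real.pi_pos
  have h0Z : (0 : ℂ) ∈ Zt L F := Or.inl L.zero_mem
  set Γ : Set ℂ := {z | ∃ n : ℤ, z = n * ℓ ∨ ∃ s, z = g₀ s + n * ℓ} with hΓ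
  have hneg : ∀ s, -g₀ s = g₀ (c - s) - ℓ := by
    intro s
    have := hsym (c - s)
    rw [show c - (c - s) = s by ring] at this
    linear_combination -this
  have hsubΓ : cz L F 0 ⊆ Γ := by
    refine C.cz_subset P G ?_ ?_ h0Z ⟨0, Or.inl (by simp)⟩
    · rintro g hg s t ⟨n, e | ⟨s', e⟩⟩
      · exact absurd (zmul_mem hℓ n) (e ▸ (hg.2 s).1)
      · refine ⟨n, Or.inr ⟨s' + (t - s), ?_⟩⟩
        have := C.lift_meet hg G.lift (zmul_mem hℓ n) e (t - s)
        rwa [show s + (t - s) = t by ring] at this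
    · have key : ∀ l ∈ L, ∀ s, g₀ s + l ∈ Γ ↔ l ∈ Γ := by
        intro l hl s
        constructor
        · rintro ⟨n, e | ⟨s', e⟩⟩
          · exfalso
            refine (G.lift.2 s).1 ?_
            rw [eq_sub_of_add_eq e]
            exact L.sub_mem (zmul_mem hℓ n) hl
          · have := (C.g0_inj G (L.sub_mem (zmul_mem hℓ n) hl) (t := s) (s := s')
              (by linear_combination e)).1
            exact ⟨n, Or.inl (by linear_combination -this)⟩
        · rintro ⟨n, e | ⟨s', e⟩⟩
          · exact ⟨n, Or.inr ⟨s, by rw [e]⟩⟩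
          · exfalso
            refine (G.lift.2 s').1 ?_
            rw [eq_sub_of_add_eq e.symm]
            exact L.sub_mem hl (zmul_mem hℓ n)
      have key2 : ∀ l, l - ℓ ∈ Γ ↔ l ∈ Γ := by
        intro l
        constructor
        · rintro ⟨n, e | ⟨s', e⟩⟩
          · exact ⟨n + 1, Or.inl (by push_cast; linear_combination e)⟩
          · exact ⟨n + 1, Or.inr ⟨s', by push_cast; linear_combination e⟩⟩
        · rintro ⟨n, e | ⟨s', e⟩⟩
          · exact ⟨n - 1, Or.inl (by push_cast; linear_combination e)⟩
          · exact ⟨n - 1, Or.inr ⟨s', by push_cast; linear_combination e⟩⟩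
      intro l hl s
      refine ⟨key l hl s, ?_⟩
      rw [hneg, show g₀ (c - s) - ℓ + l = g₀ (c - s) + (l - ℓ) by ring,
        key _ (L.sub_mem hl hℓ), key2]
  have pc := ext_path qc q0 q1
  set p : ℝ → ℂ := fun t : ℝ => q (Int.fract t) + ⌊t⌋ * ℓ with hp
  have qcase : ∀ u ∈ Ico (0 : ℝ) 1, (u = 0 ∧ q u = 0) ∨
      (0 < u ∧ q u = g₀ (Real.tan (Real.pi * (u - 1 / 2)))) := by
    rintro u ⟨a, b⟩
    rcases a.eq_or_lt with rfl | a
    · exact Or.inl ⟨rfl, q0⟩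
    · exact Or.inr ⟨a, hq u ⟨a, b⟩⟩
  have qZ : ∀ u ∈ Ico (0 : ℝ) 1, q u ∈ Zt L F := by
    intro u hu
    rcases qcase u hu with ⟨-, e⟩ | ⟨-, e⟩
    · rw [e]; exact h0Z
    · rw [e]; exact lift_mem_Zt G.lift _
  have pZ : range p ⊆ Zt L F := by
    rintro _ ⟨t, rfl⟩
    exact (C.Zt_add (zmul_mem hℓ _)).2 (qZ _ ⟨Int.fract_nonneg t, Int.fract_lt_one t⟩)
  have p0 : p 0 = 0 := by simp [hp, q0]
  have hran : range p ⊆ cz L F 0 :=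
    (isPreconnected_range pc).subset_connectedComponentIn ⟨0, p0⟩ pZ
  refine ⟨ℓ, hℓ, p, hℓ0, ⟨pc, ?_, ?_, fun t => hran ⟨t, rfl⟩, ?_⟩, hℓz, ?_, ?_⟩
  · intro t
    simp only [hp, Int.fract_add_one, Int.floor_add_one]
    push_cast; ring
  · intro s hs t ht hst
    have e : ∀ s ∈ Ico (0 : ℝ) 1, p s = q s := by
      rintro s hs
      simp only [hp]
      rw [Int.fract_eq_self.2 hs, Int.floor_eq_zero_iff.2 hs]; simp
    rw [e s hs, e t ht] at hst
    rcases qcase s hs with ⟨s0, es⟩ | ⟨s0, es⟩ <;> rcases qcase t ht with ⟨t0, et⟩ | ⟨t0, et⟩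
    · rw [s0, t0]
    · rw [es, et, zero_sub, neg_mem_iff] at hst
      exact absurd hst (G.lift.2 _).1
    · rw [es, et, sub_zero] at hst
      exact absurd hst (G.lift.2 _).1
    · rw [es, et] at hst
      have := (C.g0_inj G hst (t := Real.tan (Real.pi * (s - 1 / 2)))
        (s := Real.tan (Real.pi * (t - 1 / 2))) (by ring)).2
      have := Real.injOn_tan (by
        have := hs.2
        exact ⟨by nlinarith, by nlinarith⟩) (by
        have := ht.2
        exact ⟨by nlinarith, by nlinarith⟩) this
      have := mul_left_cancel₀ hpi.ne' this
      linarith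
  · intro z hz
    obtain ⟨n, e | ⟨s, e⟩⟩ := hsubΓ hz
    · exact ⟨n, by simp [hp, q0, e]⟩
    · set u := Real.arctan s / Real.pi + 1 / 2 with hu
      have a1 := Real.neg_pi_div_two_lt_arctan s
      have a2 := Real.arctan_lt_pi_div_two s
      have e1 : Real.arctan s / Real.pi * Real.pi = Real.arctan s := by field_simp
      have hu' : u ∈ Ioo (0 : ℝ) 1 := by
        constructor <;> nlinarith
      refine ⟨u + n, ?_⟩
      simp only [hp, Int.fract_add_intCast, Int.floor_add_intCast]
      rw [Int.fract_eq_self.2 ⟨hu'.1.le, hu'.2⟩, Int.floor_eq_zero_iff.2 ⟨hu'.1.le, hu'.2⟩, hq u hu',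
        show Real.pi * (u - 1 / 2) = Real.arctan s by rw [hu]; field_simp; ring, Real.tan_arctan, e]
      simp
  · intro l hl hlz
    obtain ⟨n, e | ⟨s, e⟩⟩ := hsubΓ hlz
    · exact ⟨n, e⟩
    · exfalso
      refine (G.lift.2 s).1 ?_
      rw [eq_sub_of_add_eq e.symm]
      exact L.sub_mem hl (zmul_mem hℓ n)
  · rintro w h2w hwL ⟨l, hl, hwl⟩
    have h2g : g₀ (c / 2) = ℓ / 2 := by linear_combination h2 / 2
    obtain ⟨n, e | ⟨s, e⟩⟩ := hsubΓ hwl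
    · exfalso
      apply hwL
      rw [eq_sub_of_add_eq e]
      exact L.sub_mem (zmul_mem hℓ n) hl
    · have hm : n * ℓ - l ∈ L := L.sub_mem (zmul_mem hℓ n) hl
      have hw : w = g₀ s + (n * ℓ - l) := by linear_combination e
      have hm2 : 2 * w - (n * ℓ - l) - (n * ℓ - l) - ℓ ∈ L :=
        L.sub_mem (L.sub_mem (L.sub_mem h2w hm) hm) hℓ
      have h3 : g₀ s = g₀ (c - s) + (2 * w - (n * ℓ - l) - (n * ℓ - l) - ℓ) := by
        have := hneg s
        linear_combination (-2) * hw + this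
      have h4 := (C.g0_inj G hm2 h3).2
      have h5 : s = c / 2 := by linarith
      rw [hw, h5, h2g]
      simpa using hm

lemma curve1 (C : Core L F) {w : ℂ} (hwZ : w ∈ Zt L F) (hw0 : ∀ l ∈ L, w + l ∉ cz L F 0) :
    ∃ ℓ ∈ L, ∃ p, IsCurve L (cz L F w) ℓ p ∧ w + ℓ ∈ cz L F w ∧
    (∀ l ∈ L, w + l ∈ cz L F w → ∃ n : ℤ, l = n * ℓ) := by
  obtain ⟨h, ρ, P⟩ := C.pc
  obtain ⟨g₀, G⟩ := C.g0_exists P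
  obtain ⟨ℓ, hℓ, c, hℓ0, hsym, h2, hlim⟩ := C.g0_sym P G
  obtain ⟨hmem, hℓz⟩ := g0_mem_cz G hℓ hlim
  have hneg : ∀ s, -g₀ s = g₀ (c - s) - ℓ := by
    intro s
    have := hsym (c - s)
    rw [show c - (c - s) = s by ring] at this
    linear_combination -this
  have h0Z : (0 : ℂ) ∈ Zt L F := Or.inl L.zero_mem
  have hwL : w ∉ L := by
    intro hw
    refine hw0 (-w) (L.neg_mem hw) ?_
    rw [add_neg_cancel]; exact mem_connectedComponentIn h0Z
  obtain ⟨g, hg, hgw⟩ := C.lift_exists hwL (hwZ.resolve_left hwL)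
  set v := (F w).im with hv
  have nt : ∀ t s, ∀ l ∈ L, g t ≠ g₀ s + l := by
    intro t s l hl e
    have := C.lift_meet hg G.lift hl e (v - t)
    rw [show t + (v - t) = v by ring, hgw] at this
    refine hw0 (-l) (L.neg_mem hl) ?_
    rw [this, add_neg_cancel_right]
    exact hmem _
  have nt' : ∀ t s, ∀ l ∈ L, g t ≠ -g₀ s + l := by
    intro t s l hl e
    refine nt t (c - s) (l - ℓ) (L.sub_mem hl hℓ) ?_
    rw [e, hneg]; ring
  obtain ⟨T, hT, l, hl, hTp⟩ : ∃ T > 0, ∃ l ∈ L, ∀ t, g (t + T) = g t + l := by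
    rcases C.dichotomy P hg 0 with ⟨t, ht, l, hl, htl⟩ | h
    · exfalso
      obtain ⟨s, hs, e | e⟩ := C.near_lat P G hl (hg.2 t).1 (by rw [(hg.2 t).2]; simp) htl
      · exact nt _ _ _ hl e
      · exact nt' _ _ _ hl e
    · exact h
  let H : AddSubgroup ℝ :=
    { carrier := {T | ∃ l ∈ L, ∀ t, g (t + T) = g t + l}
      zero_mem' := ⟨0, L.zero_mem, by simp⟩
      add_mem' := by
        rintro a b ⟨l, hl, ha⟩ ⟨m, hm, hb⟩
        refine ⟨l + m, L.add_mem hl hm, fun t => ?_⟩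
        rw [← add_assoc, hb, ha]; ring
      neg_mem' := by
        rintro a ⟨l, hl, ha⟩
        refine ⟨-l, L.neg_mem hl, fun t => ?_⟩
        have := ha (t + -a)
        rw [neg_add_cancel_right] at this
        linear_combination -this }
  have hHmem : ∀ T, T ∈ H ↔ ∃ l ∈ L, ∀ t, g (t + T) = g t + l := fun T => Iff.rfl
  have hmeet : ∀ t s, ∀ l ∈ L, g t = g s + l → t - s ∈ H := by
    intro t s l hl e
    refine ⟨l, hl, fun x => ?_⟩
    have := C.lift_meet hg hg hl e (x - s)
    rwa [show t + (x - s) = x + (t - s) by ring, show s + (x - s) = x by ring] at this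
  have hiso : ∃ a : ℝ, 0 < a ∧ Disjoint (H : Set ℝ) (Ioo 0 a) := by
    have : Tendsto (fun x => g x - g 0) (𝓝 0) (𝓝 0) := by
      have : Tendsto (fun x => g x - g 0) (𝓝 0) (𝓝 (g 0 - g 0)) :=
        Continuous.tendsto (by have := hg.1; fun_prop) 0
      simpa using this
    obtain ⟨a, ha, hb⟩ := Metric.eventually_nhds_iff.1
      (this.eventually (h.open_source.mem_nhds P.zero_mem))
    refine ⟨a, ha, Set.disjoint_left.2 ?_⟩
    rintro x ⟨l, hl, hx⟩ ⟨x0, x1⟩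
    have h1 := hb (y := x) (by rw [Real.dist_eq, sub_zero, abs_of_pos x0]; exact x1)
    have h2 := hx 0
    rw [zero_add] at h2
    have h3 : g x - g 0 = l := by rw [h2]; ring
    rw [h3] at h1
    have hl0 : l = 0 := by
      by_contra hne
      exact (P.prop _ h1 hne).1 hl
    rw [hl0, add_zero] at h2
    exact x0.ne' (lift_inj hg h2)
  obtain ⟨a, ha, hd⟩ := hiso
  obtain ⟨b', hb'⟩ := AddSubgroup.cyclic_of_isolated_zero ha hd
  have hb'' : ∃ b > 0, b ∈ H ∧ ∀ x ∈ H, ∃ n : ℤ, x = n * b := by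
    have hall : ∀ x ∈ H, ∃ n : ℤ, x = n * b' := by
      intro x hx
      rw [hb', AddSubgroup.mem_closure_singleton] at hx
      obtain ⟨n, hn⟩ := hx
      exact ⟨n, by rw [← hn]; simp⟩
    have hbH : b' ∈ H := by rw [hb']; exact AddSubgroup.mem_closure_singleton_self b'
    have hne : b' ≠ 0 := by
      rintro rfl
      obtain ⟨n, hn⟩ := hall T ⟨l, hl, hTp⟩
      simp at hn; linarith
    rcases lt_or_gt_of_ne hne with hlt | hgt
    · refine ⟨-b', by linarith, H.neg_mem hbH, fun x hx => ?_⟩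
      obtain ⟨n, hn⟩ := hall x hx
      exact ⟨-n, by push_cast; linarith⟩
    · exact ⟨b', hgt, hbH, hall⟩
  obtain ⟨b, hb, hbH, hall⟩ := hb''
  obtain ⟨ℓ₁, hℓ₁, hshift⟩ := hbH
  have hran : range g ⊆ cz L F w := by
    refine (isPreconnected_range hg.1).subset_connectedComponentIn ⟨v, hgw⟩ ?_
    rintro _ ⟨t, rfl⟩
    exact lift_mem_Zt hg t
  have hsub : cz L F w ⊆ range g := by
    refine C.cz_subset P G ?_ ?_ hwZ ⟨v, hgw⟩
    · rintro g' hg' s t ⟨x, hx⟩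
      have := C.lift_eq (t := x) hg (g' := fun y => g' (y)) hg' (by
        have e1 := lift_F_im hg x
        have e2 := lift_F_im hg' s
        rw [hx, e2] at e1
        rw [hx, e1])
      exact ⟨t, by rw [this]⟩
    · intro l hl s
      have hlr : l ∉ range g := by rintro ⟨t, rfl⟩; exact (hg.2 t).1 hl
      refine ⟨iff_of_false ?_ hlr, iff_of_false ?_ hlr⟩
      · rintro ⟨t, ht⟩; exact nt _ _ _ hl ht
      · rintro ⟨t, ht⟩; exact nt' _ _ _ hl ht
  have hcur : IsCurve L (cz L F w) ℓ₁ (fun t => g (v + b * t)) := by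
    refine ⟨by have := hg.1; fun_prop, ?_, ?_, fun t => hran ⟨_, rfl⟩, ?_⟩
    · intro t
      rw [mul_add, mul_one, ← add_assoc, hshift]
    · intro s hs t ht hst
      obtain ⟨n, hn⟩ := hall _ (hmeet (v + b * s) (v + b * t) _ hst (by ring))
      have h1 : s - t = n := by
        have : b * (s - t) = b * n := by linarith
        exact mul_left_cancel₀ hb.ne' this
      have h3 : (n : ℝ) < 1 := by linarith [hs.2, ht.1]
      have h4 : (-1 : ℝ) < n := by linarith [hs.1, ht.2]
      have h5 : n = 0 := by
        have h3' : n < 1 := by exact_mod_cast h3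
        have h4' : -1 < n := by exact_mod_cast h4
        omega
      rw [h5] at h1
      simp at h1; linarith
    · intro z hz
      obtain ⟨t, rfl⟩ := hsub hz
      refine ⟨(t - v) / b, ?_⟩
      simp only
      congr 1
      field_simp; ring
  refine ⟨ℓ₁, hℓ₁, _, hcur, ?_, ?_⟩
  · rw [← hgw, ← hshift, hgw]; exact hran ⟨_, rfl⟩
  · intro l hl hwl
    obtain ⟨t, ht⟩ := hsub hwl
    rw [← hgw] at ht
    obtain ⟨n, hn⟩ := hall _ (hmeet t v l hl ht)
    have := hcur.shift_int n 0
    simp only [mul_zero, add_zero, zero_add] at this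
    refine ⟨n, ?_⟩
    rw [show v + b * (n : ℝ) = t by linarith] at this
    rw [this] at ht
    linear_combination -ht

end Core
end ZU

namespace ZU
open Topology

/-- inverse function theorem as a chart inside a given neighbourhood -/
lemma chart_of_analytic {f : ℂ → ℂ} {a : ℂ} (hf : AnalyticAt ℂ f a) (hd : deriv f a ≠ 0) {U : Set ℂ}
    (hU : IsOpen U) (ha : a ∈ U) : ∃ h : OpenPartialHomeomorph ℂ ℂ, a ∈ h.source ∧
      ∀ x ∈ h.source, x ∈ U ∧ h x = f x := by
  have hs := hf.hasStrictDerivAt.hasStrictFDerivAt_equiv hd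
  refine ⟨(hs.toOpenPartialHomeomorph f).restrOpen U hU, ?_, ?_⟩
  · rw [OpenPartialHomeomorph.restrOpen_source]
    exact ⟨hs.mem_toOpenPartialHomeomorph_source, ha⟩
  · intro x hx
    rw [OpenPartialHomeomorph.restrOpen_source] at hx
    refine ⟨hx.2, ?_⟩
    rfl

variable (W : WeierstrassData)

lemma mem_lat (z : ℂ) : z ∈ latticeSubgroup W ↔ z ∈ W.lattice := by
  unfold latticeSubgroup WeierstrassData.lattice latticeSet
  rw [AddSubgroup.mem_closure_pair]
  simp only [Set.mem_ofPred_eq, zsmul_eq_mul]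
  constructor
  · rintro ⟨m, n, rfl⟩; exact ⟨m, n, by ring⟩
  · rintro ⟨m, n, rfl⟩; exact ⟨m, n, by ring⟩

lemma mem_lat' (z : ℂ) : z ∈ latticeSubgroup W ↔ z ∈ latticeSet W.w1 W.w3 := mem_lat W z

/-- real coordinates in the basis of half periods -/
lemma coords : ∃ A B : ℂ → ℝ, Continuous A ∧ Continuous B ∧ (∀ z, z = A z * W.w1 + B z * W.w3) ∧
    (∀ x y : ℝ, A (x * W.w1 + y * W.w3) = x) ∧ (∀ x y : ℝ, B (x * W.w1 + y * W.w3) = y) := by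
  set D : ℝ := W.w1.re * W.w3.im - W.w1.im * W.w3.re with hD
  have hD0 : D ≠ 0 := by
    intro h
    have hn : W.w1.re ^ 2 + W.w1.im ^ 2 ≠ 0 := by
      intro h0
      apply W.w1_ne
      apply Complex.ext
      · simp only [zero_re]; nlinarith [sq_nonneg W.w1.re, sq_nonneg W.w1.im]
      · simp only [zero_im]; nlinarith [sq_nonneg W.w1.re, sq_nonneg W.w1.im]
    apply W.indep ((W.w1.re * W.w3.re + W.w1.im * W.w3.im) / (W.w1.re ^ 2 + W.w1.im ^ 2))
    apply Complex.ext
    · simp only [mul_re, ofReal_re, ofReal_im, zero_mul, sub_zero]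
      field_simp
      linear_combination (-W.w1.im) * (hD.symm.trans h)
    · simp only [mul_im, ofReal_re, ofReal_im, zero_mul, add_zero]
      field_simp
      linear_combination (W.w1.re) * (hD.symm.trans h)
  refine ⟨fun z => (z.re * W.w3.im - z.im * W.w3.re) / D, fun z => (W.w1.re * z.im - W.w1.im * z.re) / D,
    by fun_prop, by fun_prop, ?_, ?_, ?_⟩
  · intro z
    apply Complex.ext
    · simp only [add_re, mul_re, ofReal_re, ofReal_im, zero_mul, sub_zero]
      field_simp
      rw [hD]; ring
    · simp only [add_im, mul_im, ofReal_re, ofReal_im, zero_mul, add_zero]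
      field_simp
      rw [hD]; ring
  · intro x y
    simp only [add_re, add_im, mul_im, mul_re, ofReal_re, ofReal_im, zero_mul, add_zero, sub_zero]
    field_simp
    rw [hD]; ring
  · intro x y
    simp only [add_re, add_im, mul_im, mul_re, ofReal_re, ofReal_im, zero_mul, add_zero, sub_zero]
    field_simp
    rw [hD]; ring

lemma lat_coords {A B : ℂ → ℝ} (hz : ∀ z, z = A z * W.w1 + B z * W.w3)
    (hA : ∀ x y : ℝ, A (x * W.w1 + y * W.w3) = x) (hB : ∀ x y : ℝ, B (x * W.w1 + y * W.w3) = y)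
    (z : ℂ) : z ∈ latticeSubgroup W ↔ ∃ m n : ℤ, A z / 2 = m ∧ B z / 2 = n := by
  rw [mem_lat']
  constructor
  · rintro ⟨m, n, rfl⟩
    have e : (2 * m * W.w1 + 2 * n * W.w3 : ℂ) = ((2 * m : ℝ) : ℂ) * W.w1 + ((2 * n : ℝ) : ℂ) * W.w3 := by
      push_cast; ring
    rw [e, hA, hB]
    exact ⟨m, n, by ring, by ring⟩
  · rintro ⟨m, n, h1, h2⟩
    refine ⟨m, n, ?_⟩
    have h1' : A z = 2 * m := by linarith
    have h2' : B z = 2 * n := by linarith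
    conv_lhs => rw [hz z, h1', h2']
    push_cast; ring

lemma lat_closed : IsClosed (latticeSubgroup W : Set ℂ) := by
  obtain ⟨A, B, cA, cB, hz, hA, hB⟩ := coords W
  have e : (latticeSubgroup W : Set ℂ) = (fun z => A z / 2) ⁻¹' range (Int.cast : ℤ → ℝ) ∩
      (fun z => B z / 2) ⁻¹' range (Int.cast : ℤ → ℝ) := by
    ext z
    rw [SetLike.mem_coe, lat_coords W hz hA hB]
    constructor
    · rintro ⟨m, n, h1, h2⟩; exact ⟨⟨m, h1.symm⟩, ⟨n, h2.symm⟩⟩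
    · rintro ⟨⟨m, h1⟩, ⟨n, h2⟩⟩; exact ⟨m, n, h1.symm, h2.symm⟩
  rw [e]
  have hc := Int.isClosedEmbedding_coe_real.isClosed_range
  exact (hc.preimage (by fun_prop)).inter (hc.preimage (by fun_prop))

lemma lat_isolated : ∃ U : Set ℂ, IsOpen U ∧ (0 : ℂ) ∈ U ∧ ∀ z ∈ U, z ∈ latticeSubgroup W → z = 0 := by
  obtain ⟨A, B, cA, cB, hz, hA, hB⟩ := coords W
  have hA0 : A 0 = 0 := by simpa using hA 0 0
  have hB0 : B 0 = 0 := by simpa using hB 0 0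
  refine ⟨{z | |A z| < 1} ∩ {z | |B z| < 1},
    (isOpen_lt (by fun_prop) (by fun_prop)).inter (isOpen_lt (by fun_prop) (by fun_prop)),
    by simp [hA0, hB0], ?_⟩
  rintro z ⟨h1, h2⟩ hzL
  obtain ⟨m, n, e1, e2⟩ := (lat_coords W hz hA hB z).1 hzL
  have key : ∀ (x : ℝ) (m : ℤ), |x| < 1 → x / 2 = m → x = 0 := by
    intro x m hx e
    rw [abs_lt] at hx
    have h1 : (m : ℝ) < 1 := by linarith
    have h2 : (-1 : ℝ) < m := by linarith
    have h1' : m < 1 := by exact_mod_cast h1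
    have h2' : -1 < m := by exact_mod_cast h2
    have : m = 0 := by omega
    rw [this] at e; simp at e; exact e
  rw [hz z, key _ m h1 e1, key _ n h2 e2]; simp

lemma lat_cpt : ∃ K : Set ℂ, IsCompact K ∧ ∀ k, ∃ l ∈ latticeSubgroup W, k + l ∈ K := by
  obtain ⟨A, B, cA, cB, hz, hA, hB⟩ := coords W
  refine ⟨(fun p : ℝ × ℝ => (p.1 : ℂ) * W.w1 + p.2 * W.w3) '' (Icc 0 2 ×ˢ Icc 0 2),
    (isCompact_Icc.prod isCompact_Icc).image (by fun_prop), fun k => ?_⟩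
  refine ⟨-(2 * ⌊A k / 2⌋ * W.w1 + 2 * ⌊B k / 2⌋ * W.w3), ?_, ?_⟩
  · rw [neg_mem_iff, mem_lat']; exact ⟨_, _, rfl⟩
  · refine ⟨(A k - 2 * ⌊A k / 2⌋, B k - 2 * ⌊B k / 2⌋), ⟨⟨?_, ?_⟩, ⟨?_, ?_⟩⟩, ?_⟩
    · have := Int.floor_le (A k / 2); simp only; linarith
    · have := Int.lt_floor_add_one (A k / 2); simp only; linarith
    · have := Int.floor_le (B k / 2); simp only; linarith
    · have := Int.lt_floor_add_one (B k / 2); simp only; linarith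
    · have h := hz k
      push_cast
      linear_combination -h

lemma lat_countable : (latticeSubgroup W : Set ℂ).Countable := by
  have : (latticeSubgroup W : Set ℂ) ⊆ range (fun p : ℤ × ℤ => (2 * p.1 * W.w1 + 2 * p.2 * W.w3 : ℂ)) := by
    intro z hz
    obtain ⟨m, n, rfl⟩ := (mem_lat' W z).1 hz
    exact ⟨(m, n), rfl⟩
  exact (countable_range _).mono this

lemma compl_preconn : IsPreconnected (latticeSubgroup W : Set ℂ)ᶜ :=
  ((lat_countable W).isPathConnected_compl_of_one_lt_rank (by
    rw [Complex.rank_real_complex]; norm_num)).isConnected.isPreconnected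

lemma half_not_mem : W.w1 ∉ latticeSubgroup W ∧ W.w3 ∉ latticeSubgroup W ∧
    W.w1 - W.w3 ∉ latticeSubgroup W := by
  obtain ⟨A, B, cA, cB, hz, hA, hB⟩ := coords W
  have key : ∀ m : ℤ, (1 : ℝ) / 2 ≠ m := by
    intro m h
    have : (1 : ℝ) = 2 * m := by linarith
    have h2 : (1 : ℤ) = 2 * m := by exact_mod_cast this
    omega
  refine ⟨?_, ?_, ?_⟩
  · rw [lat_coords W hz hA hB]
    rintro ⟨m, n, h, -⟩
    have := hA 1 0
    simp only [ofReal_one, one_mul, ofReal_zero, zero_mul, add_zero] at this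
    rw [this] at h; exact key m h
  · rw [lat_coords W hz hA hB]
    rintro ⟨m, n, -, h⟩
    have := hB 0 1
    simp only [ofReal_one, one_mul, ofReal_zero, zero_mul, zero_add] at this
    rw [this] at h; exact key n h
  · rw [lat_coords W hz hA hB]
    rintro ⟨m, n, h, -⟩
    have := hA 1 (-1)
    simp only [ofReal_one, one_mul, ofReal_neg, neg_mul] at this
    rw [← sub_eq_add_neg] at this
    rw [this] at h; exact key m h

lemma two_mem : 2 * W.w1 ∈ latticeSubgroup W ∧ 2 * W.w3 ∈ latticeSubgroup W :=
  ⟨AddSubgroup.subset_closure (by simp), AddSubgroup.subset_closure (by simp)⟩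

lemma lat_rank {l₀ : ℂ} (h₀ : l₀ ∈ latticeSubgroup W) (hne : l₀ ≠ 0) :
    ∀ a ∈ latticeSubgroup W, ∀ b ∈ latticeSubgroup W, ∃ p q r : ℤ, (p ≠ 0 ∨ q ≠ 0) ∧
      (p : ℂ) * a + q * b + r * l₀ = 0 := by
  intro a ha b hb
  obtain ⟨i, j, e0⟩ := (mem_lat' W _).1 h₀
  obtain ⟨a1, a2, ea⟩ := (mem_lat' W _).1 ha
  obtain ⟨b1, b2, eb⟩ := (mem_lat' W _).1 hb
  -- a single relation along `l₀`
  have par : ∀ p q : ℤ, (p ≠ 0 ∨ q ≠ 0) → p * (a1 * j - a2 * i) + q * (b1 * j - b2 * i) = 0 →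
      ∃ p q r : ℤ, (p ≠ 0 ∨ q ≠ 0) ∧ (p : ℂ) * a + q * b + r * l₀ = 0 := by
    intro p q hpq h
    have h' : (p : ℂ) * (a1 * j - a2 * i) + q * (b1 * j - b2 * i) = 0 := by exact_mod_cast h
    by_cases hi : i = 0
    · have hj : j ≠ 0 := by
        rintro rfl; apply hne; rw [e0, hi]; simp
      refine ⟨p * j, q * j, -(p * a2 + q * b2), ?_, ?_⟩
      · rcases hpq with h | h
        · exact Or.inl (mul_ne_zero h hj)
        · exact Or.inr (mul_ne_zero h hj)
      · rw [ea, eb, e0]; push_cast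
        linear_combination 2 * W.w1 * h'
    · refine ⟨p * i, q * i, -(p * a1 + q * b1), ?_, ?_⟩
      · rcases hpq with h | h
        · exact Or.inl (mul_ne_zero h hi)
        · exact Or.inr (mul_ne_zero h hi)
      · rw [ea, eb, e0]; push_cast
        linear_combination (-2) * W.w3 * h'
  by_cases hD : a1 * j - a2 * i = 0
  · exact par 1 0 (Or.inl one_ne_zero) (by rw [hD]; simp)
  · exact par (b1 * j - b2 * i) (-(a1 * j - a2 * i)) (Or.inr (neg_ne_zero.2 hD)) (by ring)

end ZU

namespace ZU
open Topology
variable (W : WeierstrassData)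

lemma const_off {f : ℂ → ℂ} (hd : ∀ z ∉ latticeSubgroup W, HasDerivAt f 0 z) :
    ∃ c, ∀ z ∉ latticeSubgroup W, f z = c := by
  refine (lat_closed W).isOpen_compl.exists_is_const_of_deriv_eq_zero (compl_preconn W)
    (fun z hz => (hd z hz).differentiableAt.differentiableWithinAt) (fun z hz => (hd z hz).deriv)

lemma Z_has {z : ℂ} (hz : z ∉ latticeSubgroup W) : HasDerivAt W.Z (-W.P z) z := by
  rw [mem_lat'] at hz
  rw [← W.Z_deriv z hz]; exact (W.Z_diff z hz).hasDerivAt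

lemma S_has {z : ℂ} (hz : z ∉ latticeSubgroup W) : HasDerivAt W.S (W.Z z * W.S z) z := by
  rw [mem_lat'] at hz
  rw [← W.S_deriv z hz]; exact (W.S_diff z).hasDerivAt

lemma S_ne' {z : ℂ} (hz : z ∉ latticeSubgroup W) : W.S z ≠ 0 := by
  rw [mem_lat'] at hz; exact W.S_ne z hz

lemma Z_quasi {l : ℂ} (hl : l ∈ latticeSubgroup W) :
    ∃ e, ∀ z ∉ latticeSubgroup W, W.Z (z + l) = W.Z z + e := by
  obtain ⟨e, he⟩ := const_off W (f := fun z => W.Z (z + l) - W.Z z) (fun z hz => by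
    have hz' : z + l ∉ latticeSubgroup W := by rwa [AddSubgroup.add_mem_cancel_right _ hl]
    have h := ((Z_has W hz').comp_add_const z l).sub (Z_has W hz)
    rw [W.P_periodic l ((mem_lat' W l).1 hl)] at h
    rw [sub_self] at h
    exact h)
  exact ⟨e, fun z hz => by rw [← he z hz]; ring⟩

lemma S_quasi {l e : ℂ} (hl : l ∈ latticeSubgroup W)
    (he : ∀ z ∉ latticeSubgroup W, W.Z (z + l) = W.Z z + e) :
    ∃ c, c ≠ 0 ∧ ∀ z ∉ latticeSubgroup W, W.S (z + l) = c * exp (e * z) * W.S z := by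
  obtain ⟨c, hc⟩ := const_off W (f := fun z => W.S (z + l) * exp (-(e * z)) * (W.S z)⁻¹) (fun z hz => by
    have hz' : z + l ∉ latticeSubgroup W := by rwa [AddSubgroup.add_mem_cancel_right _ hl]
    have h1 := (S_has W hz').comp_add_const z l
    have h2 : HasDerivAt (fun z : ℂ => exp (-(e * z))) (exp (-(e * z)) * (-(e * 1))) z :=
      (((hasDerivAt_id z).const_mul e).neg).cexp
    have h3 := (S_has W hz).fun_inv (S_ne' W hz)
    refine ((h1.mul h2).mul h3).congr_deriv ?_
    rw [he z hz, Pi.mul_apply]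
    have := S_ne' W hz
    field_simp
    ring)
  have hc' : ∀ z ∉ latticeSubgroup W, W.S (z + l) = c * exp (e * z) * W.S z := by
    intro z hz
    rw [← hc z hz, Complex.exp_neg]
    have := S_ne' W hz
    have := Complex.exp_ne_zero (e * z)
    field_simp
  refine ⟨c, ?_, hc'⟩
  rintro rfl
  have h1 := (half_not_mem W).1
  have hz' : W.w1 + l ∉ latticeSubgroup W := by rwa [AddSubgroup.add_mem_cancel_right _ hl]
  apply S_ne' W hz'
  rw [hc' _ h1]; simp

variable {ω : ℂ}

lemma legendre (h2 : 2 * ω ∈ latticeSubgroup W) (h1 : ω ∉ latticeSubgroup W) {l e : ℂ}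
    (hl : l ∈ latticeSubgroup W) (he : ∀ z ∉ latticeSubgroup W, W.Z (z + l) = W.Z z + e) :
    ∃ n : ℤ, W.Z ω * l - ω * e = n * Real.pi * I := by
  obtain ⟨m, hm⟩ := Z_quasi W h2
  have hmv : m = 2 * W.Z ω := by
    have h := hm (-ω) (by rwa [neg_mem_iff])
    rw [W.Z_odd, show -ω + 2 * ω = ω by ring] at h
    linear_combination -h
  obtain ⟨c, hc0, hc⟩ := S_quasi W hl he
  obtain ⟨d, hd0, hd⟩ := S_quasi W h2 hm
  have hz := h1
  have hz1 : ω + l ∉ latticeSubgroup W := by rwa [AddSubgroup.add_mem_cancel_right _ hl]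
  have hz2 : ω + 2 * ω ∉ latticeSubgroup W := by rwa [AddSubgroup.add_mem_cancel_right _ h2]
  have a1 := hd _ hz1
  have a2 := hc _ hz2
  rw [hc _ hz] at a1
  rw [hd _ hz] at a2
  rw [show ω + l + 2 * ω = ω + 2 * ω + l by ring, a2] at a1
  rw [mul_add, mul_add, Complex.exp_add, Complex.exp_add] at a1
  have hS := S_ne' W hz
  have E1 := Complex.exp_ne_zero (e * ω)
  have E2 := Complex.exp_ne_zero (m * ω)
  have key : exp (e * (2 * ω)) = exp (m * l) := by
    have hne : c * d * exp (e * ω) * exp (m * ω) * W.S ω ≠ 0 := by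
      simp only [ne_eq, mul_eq_zero, not_or]; tauto
    apply mul_left_cancel₀ hne
    linear_combination a1
  obtain ⟨n, hn⟩ := Complex.exp_eq_exp_iff_exists_int.1 key.symm
  refine ⟨n, ?_⟩
  rw [hmv] at hn
  linear_combination hn / 2

lemma S_zero : W.S 0 = 0 ∧ deriv W.S 0 = 1 := by
  have h0 : W.S 0 = 0 := by
    have t1 : Tendsto W.S (𝓝[≠] 0) (𝓝 (W.S 0)) :=
      (W.S_diff 0).continuousAt.tendsto.mono_left nhdsWithin_le_nhds
    have t2 : Tendsto (fun z => W.S z / z * z) (𝓝[≠] 0) (𝓝 (1 * 0)) :=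
      W.S_norm.mul (tendsto_id.mono_left nhdsWithin_le_nhds)
    have t3 : Tendsto W.S (𝓝[≠] 0) (𝓝 (1 * 0)) := by
      refine t2.congr' ?_
      filter_upwards [self_mem_nhdsWithin] with z hz
      rw [div_mul_cancel₀ _ hz]
    rw [tendsto_nhds_unique t1 t3]; simp
  refine ⟨h0, HasDerivAt.deriv ?_⟩
  rw [hasDerivAt_iff_tendsto_slope]
  refine W.S_norm.congr' ?_
  filter_upwards [self_mem_nhdsWithin] with z hz
  rw [slope_def_field, h0]; simp

/-- the function whose real part is `u` -/
def FF (ω : ℂ) : ℂ → ℂ := fun k => W.Z ω * k - ω * W.Z k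

/-- numerator of `FF` -/
def NN (ω : ℂ) : ℂ → ℂ := fun k => W.Z ω * k * W.S k - ω * deriv W.S k

lemma NN_eq {k : ℂ} (hk : k ∉ latticeSubgroup W) : NN W ω k = FF W ω k * W.S k := by
  unfold NN FF; rw [(S_has W hk).deriv]; ring

lemma NN_zero : NN W ω 0 = -ω := by
  unfold NN; rw [(S_zero W).1, (S_zero W).2]; simp

lemma NN_diff : Differentiable ℂ (NN W ω) := by
  unfold NN
  have h : Differentiable ℂ (deriv W.S) := W.S_diff.deriv
  have := W.S_diff
  fun_prop

lemma FF_has {k : ℂ} (hk : k ∉ latticeSubgroup W) : HasDerivAt (FF W ω) (W.Z ω + ω * W.P k) k := by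
  have h := ((hasDerivAt_id k).const_mul (W.Z ω)).sub ((Z_has W hk).const_mul ω)
  refine h.congr_deriv ?_
  ring

lemma FF_anOn : AnalyticOnNhd ℂ (FF W ω) (latticeSubgroup W : Set ℂ)ᶜ :=
  DifferentiableOn.analyticOnNhd
    (fun _ hk => (FF_has W hk).differentiableAt.differentiableWithinAt) (lat_closed W).isOpen_compl

lemma core (h2 : 2 * ω ∈ latticeSubgroup W) (h1 : ω ∉ latticeSubgroup W)
    (hns : ∀ k ∉ latticeSubgroup W, W.Z ω + ω * W.P k = 0 → (FF W ω k).re ≠ 0) :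
    Core (latticeSubgroup W) (FF W ω) where
  closed := lat_closed W
  cont := fun k hk => (FF_has W hk).continuousAt
  per := by
    intro l hl
    obtain ⟨e, he⟩ := Z_quasi W hl
    obtain ⟨n, hn⟩ := legendre W h2 h1 hl he
    refine ⟨n * Real.pi, fun k hk => ?_⟩
    unfold FF
    rw [he k hk]; push_cast
    linear_combination hn
  odd := by intro k; unfold FF; rw [W.Z_odd]; ring
  cpt := lat_cpt W
  reg := by
    intro k hk hre
    refine chart_of_analytic (FF_anOn W k hk) ?_ (lat_closed W).isOpen_compl hk
    rw [(FF_has W hk).deriv]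
    exact fun h => hns k hk h hre
  pole := by
    have hω : ω ≠ 0 := by rintro rfl; exact h1 (zero_mem _)
    have hN0 : NN W ω 0 ≠ 0 := by rw [NN_zero]; exact neg_ne_zero.2 hω
    obtain ⟨U, hUo, h0U, hU⟩ := lat_isolated W
    have hSh : HasDerivAt W.S 1 0 := by
      rw [← (S_zero W).2]; exact (W.S_diff 0).hasDerivAt
    have hd := hSh.div (NN_diff W (ω := ω) 0).hasDerivAt hN0
    have hop : IsOpen {z | NN W ω z ≠ 0} := isOpen_ne_fun (NN_diff W).continuous continuous_const
    obtain ⟨h, h0, hh⟩ := chart_of_analytic (f := W.S / NN W ω) (a := 0)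
      ((W.S_diff.analyticAt 0).div ((NN_diff W).analyticAt 0) hN0)
      (by
        rw [hd.deriv, (S_zero W).1]
        simp [hN0]) (hUo.inter hop) ⟨h0U, hN0⟩
    refine ⟨h, h0, ?_, ?_⟩
    · rw [(hh 0 h0).2, Pi.div_apply, (S_zero W).1, zero_div]
    · intro x hx hx0
      obtain ⟨⟨hxU, hxN⟩, e⟩ := hh x hx
      have hxL : x ∉ latticeSubgroup W := fun hm => hx0 (hU x hxU hm)
      have hxN' : NN W ω x ≠ 0 := hxN
      rw [NN_eq W hxL] at hxN'
      refine ⟨hxL, left_ne_zero_of_mul hxN', ?_⟩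
      rw [e, Pi.div_apply, NN_eq W hxL]
      have := left_ne_zero_of_mul hxN'
      have := right_ne_zero_of_mul hxN'
      field_simp
  opn := by
    intro k hk
    refine (FF_anOn W k hk).eventually_constant_or_nhds_le_map_nhds.resolve_left ?_
    intro hcon
    have hω : ω ≠ 0 := by rintro rfl; exact h1 (zero_mem _)
    have heq := (FF_anOn W (ω := ω)).eqOn_of_preconnected_of_eventuallyEq
      (g := fun _ => FF W ω k) analyticOnNhd_const (compl_preconn W) hk hcon
    have hall : NN W ω = fun z => FF W ω k * W.S z := by
      have hdense : Dense (latticeSubgroup W : Set ℂ)ᶜ := (lat_countable W).dense_compl ℝ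
      refine Continuous.ext_on hdense (NN_diff W).continuous
        (continuous_const.mul W.S_diff.continuous) ?_
      intro z hz
      rw [NN_eq W hz]
      have h := heq hz
      simp only at h ⊢
      rw [h]
    have h0 := congrFun hall 0
    simp only [NN_zero, (S_zero W).1, mul_zero] at h0
    exact hω (neg_eq_zero.1 h0)

end ZU

namespace ZU
open Topology
variable {L : AddSubgroup ℂ} {F : ℂ → ℂ}

lemma IsCurve.inj' {S : Set ℂ} {ℓ : ℂ} {p : ℝ → ℂ} (h : IsCurve L S ℓ p) (hℓ : ℓ ∈ L) {s t : ℝ}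
    (hst : p s - p t ∈ L) : ∃ n : ℤ, s = t + n := by
  have e : ∀ t : ℝ, p t = p (Int.fract t) + ⌊t⌋ * ℓ := by
    intro t
    rw [← h.shift_int, Int.fract_add_floor]
  rw [e s, e t] at hst
  have h2 : p (Int.fract s) - p (Int.fract t) ∈ L := by
    have := L.sub_mem hst (zmul_mem hℓ (⌊s⌋ - ⌊t⌋))
    convert this using 1
    push_cast; ring
  have := h.inj _ ⟨Int.fract_nonneg s, Int.fract_lt_one s⟩ _ ⟨Int.fract_nonneg t, Int.fract_lt_one t⟩ h2
  refine ⟨⌊s⌋ - ⌊t⌋, ?_⟩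
  unfold Int.fract at this
  push_cast; linarith

lemma IsCurve.reverse {S : Set ℂ} {ℓ : ℂ} {p : ℝ → ℂ} (h : IsCurve L S ℓ p) (hℓ : ℓ ∈ L) :
    IsCurve L S (-ℓ) (fun t => p (-t)) where
  cont := h.cont.comp continuous_neg
  shift := by
    intro t
    have := h.shift (-(t + 1))
    rw [show -(t + 1) + 1 = -t by ring] at this
    simp only [this]; ring
  inj := by
    intro s hs t ht hst
    obtain ⟨n, hn⟩ := h.inj' hℓ hst
    have h1 : (n : ℝ) < 1 := by linarith [hs.1, ht.2]
    have h2 : (-1 : ℝ) < n := by linarith [hs.2, ht.1]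
    have h1' : n < 1 := by exact_mod_cast h1
    have h2' : -1 < n := by exact_mod_cast h2
    have : n = 0 := by omega
    rw [this] at hn; simp at hn; exact hn
  mem := fun t => h.mem _
  sub := by
    intro x hx
    obtain ⟨t, rfl⟩ := h.sub hx
    exact ⟨-t, by simp⟩

lemma mk_periodic {p : ℝ → ℂ} {ℓ : ℂ} (hs : ∀ t, p (t + 1) = p t + ℓ) (hℓ : ℓ ∈ L) :
    Function.Periodic (fun t => (QuotientAddGroup.mk (p t) : ℂ ⧸ L)) 1 := by
  intro t
  simp only [hs]
  rw [QuotientAddGroup.mk_add_of_mem _ hℓ]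

lemma exists_loop {p : ℝ → ℂ} {ℓ : ℂ} (hc : Continuous p) (hs : ∀ t, p (t + 1) = p t + ℓ)
    (hℓ : ℓ ∈ L) : ∃ γ : C(AddCircle (1 : ℝ), ℂ ⧸ L), ∀ t : ℝ,
      γ (t : AddCircle (1 : ℝ)) = (QuotientAddGroup.mk (p t) : ℂ ⧸ L) := by
  have hp := mk_periodic (L := L) hs hℓ
  refine ⟨⟨hp.lift, ?_⟩, fun t => rfl⟩
  rw [QuotientAddGroup.isOpenQuotientMap_mk.isQuotientMap.continuous_iff]
  exact continuous_quotient_mk'.comp hc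

lemma loops_homotopic {p q : ℝ → ℂ} {ℓ : ℂ} (pc : Continuous p) (qc : Continuous q)
    (ps : ∀ t, p (t + 1) = p t + ℓ) (qs : ∀ t, q (t + 1) = q t + ℓ)
    (hℓ : ℓ ∈ L) {γ δ : C(AddCircle (1 : ℝ), ℂ ⧸ L)}
    (hγ : ∀ t : ℝ, γ (t : AddCircle (1 : ℝ)) = (QuotientAddGroup.mk (p t) : ℂ ⧸ L))
    (hδ : ∀ t : ℝ, δ (t : AddCircle (1 : ℝ)) = (QuotientAddGroup.mk (q t) : ℂ ⧸ L)) :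
    ContinuousMap.Homotopic γ δ := by
  have hp : ∀ s : unitInterval, Function.Periodic (fun t =>
      (QuotientAddGroup.mk ((1 - ((s : ℝ) : ℂ)) * p t + ((s : ℝ) : ℂ) * q t) : ℂ ⧸ L)) 1 :=
    fun s => mk_periodic (ℓ := ℓ) (fun t => by rw [ps, qs]; ring) hℓ
  refine ⟨⟨⟨fun x => (hp x.1).lift x.2, ?_⟩, ?_, ?_⟩⟩
  · have hq : IsOpenQuotientMap (Prod.map (id : unitInterval → unitInterval)
        (QuotientAddGroup.mk : ℝ → AddCircle (1 : ℝ))) :=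
      IsOpenQuotientMap.id.prodMap QuotientAddGroup.isOpenQuotientMap_mk
    rw [hq.isQuotientMap.continuous_iff]
    refine continuous_quotient_mk'.comp (f := fun x : unitInterval × ℝ =>
      (1 - ((x.1 : ℝ) : ℂ)) * p x.2 + ((x.1 : ℝ) : ℂ) * q x.2) ?_
    fun_prop
  · intro x
    induction x using QuotientAddGroup.induction_on with
    | H t =>
      have := hγ t
      refine Eq.trans ?_ this.symm
      change (QuotientAddGroup.mk _ : ℂ ⧸ L) = _
      simp
  · intro x
    induction x using QuotientAddGroup.induction_on with
    | H t =>
      have := hδ t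
      refine Eq.trans ?_ this.symm
      change (QuotientAddGroup.mk _ : ℂ ⧸ L) = _
      simp

lemma addCircle_eq {x y : ℝ} (h : (x : AddCircle (1 : ℝ)) = y) : ∃ n : ℤ, x - y = n := by
  rw [eq_comm, QuotientAddGroup.eq, AddSubgroup.mem_zmultiples_iff] at h
  obtain ⟨n, hn⟩ := h
  exact ⟨n, by rw [zsmul_eq_mul, mul_one] at hn; linarith⟩

lemma int_const {X : Type*} [TopologicalSpace X] [PreconnectedSpace X] {f : X → ℝ} (hf : Continuous f)
    (hi : ∀ x, ∃ n : ℤ, f x = n) (x y : X) : f x = f y := by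
  choose g hg using hi
  have hfg : f = fun x => (g x : ℝ) := funext hg
  have gc : Continuous g := by
    rw [Int.isClosedEmbedding_coe_real.isInducing.continuous_iff]
    rw [hfg] at hf; exact hf
  have := PreconnectedSpace.constant ‹PreconnectedSpace X› gc (x := x) (y := y)
  rw [hg, hg, this]

lemma not_null {p : ℝ → ℂ} {ℓ : ℂ} (pc : Continuous p) (ps : ∀ t, p (t + 1) = p t + ℓ)
    {a : ℂ → ℝ} (ac : Continuous a) (aadd : ∀ x y, a (x + y) = a x + a y)
    (aL : ∀ l ∈ L, ∃ n : ℤ, a l = n) (hne : a ℓ ≠ 0)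
    {γ : C(AddCircle (1 : ℝ), ℂ ⧸ L)}
    (hγ : ∀ t : ℝ, γ (t : AddCircle (1 : ℝ)) = (QuotientAddGroup.mk (p t) : ℂ ⧸ L)) :
    ¬ ∃ c : ℂ ⧸ L, ContinuousMap.Homotopic γ (ContinuousMap.const _ c) := by
  rintro ⟨c, ⟨G⟩⟩
  let χ : ℂ ⧸ L → AddCircle (1 : ℝ) := Quotient.lift (fun z => ((a z : ℝ) : AddCircle (1 : ℝ))) (by
    intro x y hxy
    have hxy' : -x + y ∈ L := QuotientAddGroup.leftRel_apply.1 hxy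
    obtain ⟨n, hn⟩ := aL _ hxy'
    have : a y = a x + n := by
      rw [← hn, ← aadd]; congr 1; ring
    simp only [this]
    rw [AddCircle.coe_add]
    have : ((n : ℝ) : AddCircle (1 : ℝ)) = 0 := by
      rw [AddCircle.coe_eq_zero_iff]; exact ⟨n, by simp⟩
    rw [this, add_zero])
  have χc : Continuous χ := by
    rw [QuotientAddGroup.isOpenQuotientMap_mk.isQuotientMap.continuous_iff]
    exact (AddCircle.continuous_mk' 1).comp ac
  let H : C(unitInterval × ℝ, AddCircle (1 : ℝ)) :=
    ⟨fun x => χ (G (x.1, (x.2 : AddCircle (1 : ℝ)))), χc.comp (G.continuous.comp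
      (continuous_fst.prodMk ((AddCircle.continuous_mk' 1).comp continuous_snd)))⟩
  let f : C(ℝ, ℝ) := ⟨fun t => a (p t), ac.comp pc⟩
  have cov := AddCircle.isCoveringMap_coe (1 : ℝ)
  have H0 : ∀ t, H (0, t) = ((f t : ℝ) : AddCircle (1 : ℝ)) := by
    intro t
    change χ (G (0, _)) = _
    rw [G.apply_zero, hγ]
    rfl
  have lft := cov.liftHomotopy_lifts H f H0
  have lf0 := cov.liftHomotopy_zero H f H0
  set K := cov.liftHomotopy H f H0 with hK
  have lft' : ∀ x, ((K x : ℝ) : AddCircle (1 : ℝ)) = H x := fun x => congrFun lft x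
  have kc := K.continuous
  have i1 := int_const (X := unitInterval × ℝ) (f := fun x => K (x.1, x.2 + 1) - K (x.1, x.2))
    (by fun_prop) (fun x => addCircle_eq (by
      rw [lft', lft']
      change χ (G (_, _)) = χ (G (_, _))
      simp [AddCircle.coe_add]))
    (0, 0) (1, 0)
  have i2 := int_const (X := ℝ) (f := fun x => K (1, x) - K (1, 0))
    (by fun_prop) (fun x => addCircle_eq (by
      rw [lft', lft']
      change χ (G (_, _)) = χ (G (_, _))
      simp)) 1 0
  simp only [zero_add] at i1 i2
  rw [lf0, lf0] at i1
  have e : f 1 - f 0 = a ℓ := by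
    change a (p 1) - a (p 0) = a ℓ
    have := ps 0
    rw [zero_add] at this
    rw [this, aadd]; ring
  apply hne
  rw [← e, i1, i2, sub_self]

end ZU

namespace ZU
open Topology

section gen
variable {L : AddSubgroup ℂ} {F : ℂ → ℂ}

lemma half_mem (C : Core L F) {w : ℂ} (h2 : 2 * w ∈ L) (h1 : w ∉ L) : w ∈ Zt L F := by
  right
  have h := C.re_per h2 (k := -w) (by rwa [neg_mem_iff])
  rw [show -w + 2 * w = w by ring, C.odd, neg_re] at h
  linarith

lemma cz_symm {x y : ℂ} (h : y ∈ cz L F x) : cz L F x = cz L F y := connectedComponentIn_eq h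

/-- translates of a component meeting another component -/
lemma cz_translate (C : Core L F) {x y z l : ℂ} (hl : l ∈ L) (hx : x ∈ Zt L F) (hy : y ∈ Zt L F)
    (h1 : z ∈ cz L F x) (h2 : z + l ∈ cz L F y) : x + l ∈ cz L F y := by
  have h3 : z + l ∈ cz L F (x + l) := by
    rw [C.cz_add hl hx]; exact ⟨z, h1, rfl⟩
  rw [cz_symm h2, ← cz_symm h3]
  exact mem_connectedComponentIn ((C.Zt_add hl).2 hx)

lemma eq_or_neg {ℓ₀ ℓ₁ : ℂ} (h0 : ℓ₀ ≠ 0) {m n : ℤ} (h1 : ℓ₀ = n * ℓ₁) (h2 : ℓ₁ = m * ℓ₀) :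
    ℓ₁ = ℓ₀ ∨ ℓ₁ = -ℓ₀ := by
  have h : ((n * m : ℤ) : ℂ) * ℓ₀ = 1 * ℓ₀ := by
    push_cast; rw [mul_assoc, ← h2, ← h1, one_mul]
  have h' := mul_right_cancel₀ h0 h
  have h3 : n * m = 1 := by exact_mod_cast h'
  rcases Int.eq_one_or_neg_one_of_mul_eq_one (by rw [mul_comm] at h3; exact h3 : m * n = 1) with h | h
  · left; rw [h2, h]; simp
  · right; rw [h2, h]; simp

lemma two_curves (C : Core L F) {w₁ w₃ : ℂ} (h1 : w₁ ∉ L) (h3 : w₃ ∉ L) (h13 : w₁ - w₃ ∉ L)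
    (d1 : 2 * w₁ ∈ L) (d3 : 2 * w₃ ∈ L)
    (hrank : ∀ l₀ ∈ L, l₀ ≠ 0 → ∀ a ∈ L, ∀ b ∈ L, ∃ p q r : ℤ, (p ≠ 0 ∨ q ≠ 0) ∧
      (p : ℂ) * a + q * b + r * l₀ = 0) :
    ∃ ℓ ∈ L, ∃ w p q, ℓ ≠ 0 ∧ IsCurve L (cz L F 0) ℓ p ∧ IsCurve L (cz L F w) ℓ q ∧ w ∈ Zt L F ∧
      (∀ l ∈ L, w + l ∉ cz L F 0) ∧
      ∀ z ∈ Zt L F, ∃ l ∈ L, z + l ∈ cz L F 0 ∨ z + l ∈ cz L F w := by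
  obtain ⟨ℓ, hℓ, p, hℓ0, hp, hℓz, hst, htor⟩ := C.curve0
  have h0Z : (0 : ℂ) ∈ Zt L F := Or.inl L.zero_mem
  obtain ⟨w, hw, hw2, hww⟩ : ∃ w, w ∉ L ∧ 2 * w ∈ L ∧ w - ℓ / 2 ∉ L := by
    by_cases h : w₁ - ℓ / 2 ∈ L
    · refine ⟨w₃, h3, d3, fun h' => h13 ?_⟩
      have := L.sub_mem h h'
      convert this using 1
      ring
    · exact ⟨w₁, h1, d1, h⟩
  have hwZ := half_mem C hw2 hw
  have hw0 : ∀ l ∈ L, w + l ∉ cz L F 0 := fun l hl h => hww (htor w hw2 hw ⟨l, hl, h⟩)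
  obtain ⟨ℓ₁, hℓ₁, q, hq, hwq, hst1⟩ := C.curve1 hwZ hw0
  obtain ⟨m, hm⟩ := hst ℓ₁ hℓ₁ ((C.stab_iff hwZ hw2 hℓ₁).2 hwq)
  obtain ⟨n, hn⟩ := hst1 ℓ hℓ ((C.stab_iff hwZ hw2 hℓ).1 hℓz)
  have hcov : ∀ z ∈ Zt L F, ∃ l ∈ L, z + l ∈ cz L F 0 ∨ z + l ∈ cz L F w := by
    intro z hz
    by_contra hcon
    push Not at hcon
    refine C.no_third hz hwZ hℓ hℓz (hrank ℓ hℓ hℓ0) ?_ ?_ ?_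
    · intro l hl h
      refine (hcon (-l) (L.neg_mem hl)).1 ?_
      exact cz_translate C (L.neg_mem hl) hz h0Z h (by
        rw [add_neg_cancel]; exact mem_connectedComponentIn h0Z)
    · intro l hl h
      refine hw0 (-l) (L.neg_mem hl) ?_
      exact cz_translate C (L.neg_mem hl) hwZ h0Z h (by
        rw [add_neg_cancel]; exact mem_connectedComponentIn h0Z)
    · intro l hl h
      refine (hcon (-l) (L.neg_mem hl)).2 ?_
      exact cz_translate C (L.neg_mem hl) hz hwZ h (by
        rw [add_neg_cancel_right]; exact mem_connectedComponentIn hwZ)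
  rcases eq_or_neg hℓ0 hn hm with h | h
  · exact ⟨ℓ, hℓ, w, p, q, hℓ0, hp, h ▸ hq, hwZ, hw0, hcov⟩
  · refine ⟨ℓ, hℓ, w, p, fun t => q (-t), hℓ0, hp, ?_, hwZ, hw0, hcov⟩
    have := hq.reverse hℓ₁
    rw [h, neg_neg] at this
    exact this

lemma loop_inj {S : Set ℂ} {p : ℝ → ℂ} {ℓ : ℂ} (hp : IsCurve L S ℓ p) (hℓ : ℓ ∈ L)
    {γ : C(AddCircle (1 : ℝ), ℂ ⧸ L)}
    (hγ : ∀ t : ℝ, γ (t : AddCircle (1 : ℝ)) = (QuotientAddGroup.mk (p t) : ℂ ⧸ L)) :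
    Function.Injective γ := by
  intro x y hxy
  induction x using QuotientAddGroup.induction_on with
  | H s =>
  induction y using QuotientAddGroup.induction_on with
  | H t =>
    have e : (QuotientAddGroup.mk (p s) : ℂ ⧸ L) = QuotientAddGroup.mk (p t) := by
      rw [← hγ, ← hγ]; exact hxy
    rw [eq_comm, QuotientAddGroup.eq] at e
    obtain ⟨n, hn⟩ := hp.inj' hℓ (s := s) (t := t) (by rw [sub_eq_neg_add]; exact e)
    rw [QuotientAddGroup.eq, AddSubgroup.mem_zmultiples_iff]
    refine ⟨-n, ?_⟩
    rw [hn]; simp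

lemma loop_range {S : Set ℂ} {p : ℝ → ℂ} {ℓ : ℂ} (hp : IsCurve L S ℓ p)
    {γ : C(AddCircle (1 : ℝ), ℂ ⧸ L)}
    (hγ : ∀ t : ℝ, γ (t : AddCircle (1 : ℝ)) = (QuotientAddGroup.mk (p t) : ℂ ⧸ L)) :
    range γ = (QuotientAddGroup.mk : ℂ → ℂ ⧸ L) '' S := by
  apply Subset.antisymm
  · rintro _ ⟨x, rfl⟩
    induction x using QuotientAddGroup.induction_on with
    | H s => exact ⟨p s, hp.mem s, (hγ s).symm⟩
  · rintro _ ⟨x, hx, rfl⟩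
    obtain ⟨t, rfl⟩ := hp.sub hx
    exact ⟨_, hγ t⟩

/-- the closure of the zero set -/
lemma closure_eq (C : Core L F) {p : ℝ → ℂ} {ℓ : ℂ} (hp : IsCurve L (cz L F 0) ℓ p) (hℓ : ℓ ∈ L) :
    closure ((QuotientAddGroup.mk : ℂ → ℂ ⧸ L) '' {k | k ∉ L ∧ (F k).re = 0}) =
      (QuotientAddGroup.mk : ℂ → ℂ ⧸ L) '' Zt L F := by
  apply Subset.antisymm
  · apply closure_minimal
    · exact image_mono (fun k hk => Or.inr hk.2)
    · rw [← QuotientAddGroup.isOpenQuotientMap_mk.isQuotientMap.isClosed_preimage]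
      have : (QuotientAddGroup.mk : ℂ → ℂ ⧸ L) ⁻¹' ((QuotientAddGroup.mk : ℂ → ℂ ⧸ L) '' Zt L F) = Zt L F := by
        apply Subset.antisymm _ (subset_preimage_image _ _)
        rintro x ⟨y, hy, hxy⟩
        rw [QuotientAddGroup.eq] at hxy
        have := (C.Zt_add hxy).2 hy
        rwa [add_neg_cancel_left] at this
      rw [this]; exact C.isClosed_Zt
  · -- a point of the curve through the lattice point
    have h0Z : (0 : ℂ) ∈ Zt L F := Or.inl L.zero_mem
    obtain ⟨t₀, ht₀⟩ := hp.sub (mem_connectedComponentIn h0Z)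
    have h0 : (QuotientAddGroup.mk (0 : ℂ) : ℂ ⧸ L) ∈
        closure ((QuotientAddGroup.mk : ℂ → ℂ ⧸ L) '' {k | k ∉ L ∧ (F k).re = 0}) := by
      have hlim : Tendsto (fun n : ℕ => (QuotientAddGroup.mk (p (t₀ + 1 / ((n : ℝ) + 1 + 1))) : ℂ ⧸ L))
          atTop (𝓝 (QuotientAddGroup.mk (0 : ℂ))) := by
        have h1 : Tendsto (fun n : ℕ => t₀ + 1 / ((n : ℝ) + 1 + 1)) atTop (𝓝 (t₀ + 0)) := by
          refine tendsto_const_nhds.add ?_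
          have := (tendsto_one_div_add_atTop_nhds_zero_nat (𝕜 := ℝ)).comp (tendsto_add_atTop_nat 1)
          refine this.congr (fun n => ?_)
          simp
        rw [add_zero] at h1
        have h2 := (hp.cont.tendsto t₀).comp h1
        rw [ht₀] at h2
        exact (continuous_quotient_mk'.tendsto (0 : ℂ)).comp h2
      refine mem_closure_of_tendsto hlim (Eventually.of_forall (fun n => ?_))
      have hnL : p (t₀ + 1 / ((n : ℝ) + 1 + 1)) ∉ L := by
        intro h
        obtain ⟨m, hm⟩ := hp.inj' hℓ (s := t₀ + 1 / ((n : ℝ) + 1 + 1)) (t := t₀) (by rw [ht₀, sub_zero]; exact h)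
        have hm' : 1 / ((n : ℝ) + 1 + 1) = m := by linarith
        have hpos : (0 : ℝ) < 1 / ((n : ℝ) + 1 + 1) := by positivity
        have hlt : 1 / ((n : ℝ) + 1 + 1) < 1 := by
          rw [div_lt_one (by positivity)]
          have : (0 : ℝ) ≤ n := Nat.cast_nonneg n
          linarith
        rw [hm'] at hpos hlt
        have a1 : 0 < m := by exact_mod_cast hpos
        have a2 : m < 1 := by exact_mod_cast hlt
        omega
      refine mem_image_of_mem _ ⟨hnL, ?_⟩
      exact (connectedComponentIn_subset _ _ (hp.mem _)).resolve_left hnL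
    rintro _ ⟨k, hk, rfl⟩
    by_cases hkL : k ∈ L
    · have : (QuotientAddGroup.mk k : ℂ ⧸ L) = QuotientAddGroup.mk (0 : ℂ) := by
        rw [eq_comm, QuotientAddGroup.eq]; simpa using hkL
      rw [this]; exact h0
    · exact subset_closure (mem_image_of_mem _ ⟨hkL, hk.resolve_left hkL⟩)

end gen

/-- a real linear coordinate detecting a nonzero lattice vector -/
lemma detect (W : WeierstrassData) {ℓ : ℂ} (h0 : ℓ ≠ 0) :
    ∃ a : ℂ → ℝ, Continuous a ∧ (∀ x y, a (x + y) = a x + a y) ∧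
      (∀ l ∈ latticeSubgroup W, ∃ n : ℤ, a l = n) ∧ a ℓ ≠ 0 := by
  obtain ⟨A, B, cA, cB, hz, hA, hB⟩ := coords W
  have key : ∀ x y, x + y = ((A x + A y : ℝ) : ℂ) * W.w1 + ((B x + B y : ℝ) : ℂ) * W.w3 := by
    intro x y
    have h1 := hz x
    have h2 := hz y
    push_cast
    linear_combination h1 + h2
  by_cases h : A ℓ = 0
  · refine ⟨fun z => B z / 2, by fun_prop, ?_, ?_, ?_⟩
    · intro x y; simp only; rw [key, hB]; ring
    · intro l hl
      obtain ⟨m, n, -, h2⟩ := (lat_coords W hz hA hB l).1 hl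
      exact ⟨n, h2⟩
    · intro hB0
      have : B ℓ = 0 := by simpa using hB0
      apply h0; rw [hz ℓ, h, this]; simp
  · refine ⟨fun z => A z / 2, by fun_prop, ?_, ?_, ?_⟩
    · intro x y; simp only; rw [key, hA]; ring
    · intro l hl
      obtain ⟨m, n, h2, -⟩ := (lat_coords W hz hA hB l).1 hl
      exact ⟨m, h2⟩
    · intro hA0
      exact h (by simpa using hA0)

end ZU

/-- Under the non-degeneracy conditions `η + ωeⱼ ≠ 0` and the
non-singularity condition `u(k*) ≠ 0` at the critical points of `u`, the closure
in `𝓔 = ℂ/𝓛` of the zero set `Z_u = {k ∈ 𝓔^× : u(k) = 0}` consists of two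
disjoint simple closed curves representing the same non-trivial homology class
(equivalently, freely homotopic, non null-homotopic loops in the torus). -/
theorem zero_set_of_u_is_two_simple_closed_curves
    (W : WeierstrassData) (ω : ℂ) (hω : 2 * ω ∈ W.lattice) (hω' : ω ∉ W.lattice)
    (hnd : W.Z ω + ω * W.e1 ≠ 0 ∧ W.Z ω + ω * W.e2 ≠ 0 ∧ W.Z ω + ω * W.e3 ≠ 0)
    (hns : ∀ k ∉ W.lattice, W.Z ω + ω * W.P k = 0 → W.uFun ω k ≠ 0) :
    ∃ γ₁ γ₂ : C(AddCircle (1 : ℝ), ℂ ⧸ latticeSubgroup W),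
      Function.Injective γ₁ ∧ Function.Injective γ₂ ∧
      Set.range γ₁ ∩ Set.range γ₂ = ∅ ∧
      closure ((QuotientAddGroup.mk : ℂ → ℂ ⧸ latticeSubgroup W) ''
          {k : ℂ | k ∉ W.lattice ∧ W.uFun ω k = 0})
        = Set.range γ₁ ∪ Set.range γ₂ ∧
      ContinuousMap.Homotopic γ₁ γ₂ ∧
      ¬ ∃ c : ℂ ⧸ latticeSubgroup W,
          ContinuousMap.Homotopic γ₁ (ContinuousMap.const _ c) := by
  have hL := ZU.mem_lat W
  have C : ZU.Core (latticeSubgroup W) (ZU.FF W ω) := by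
    refine ZU.core W ((hL _).2 hω) (fun h => hω' ((hL _).1 h)) ?_
    intro k hk h
    exact hns k (fun h => hk ((hL _).2 h)) h
  obtain ⟨a1, a3, a13⟩ := ZU.half_not_mem W
  obtain ⟨d1, d3⟩ := ZU.two_mem W
  obtain ⟨ℓ, hℓ, w, p, q, hℓ0, hp, hq, hwZ, hw0, hcov⟩ :=
    ZU.two_curves C a1 a3 a13 d1 d3 (fun l hl h0 => ZU.lat_rank W hl h0)
  obtain ⟨γ, hγ⟩ := ZU.exists_loop hp.cont hp.shift hℓ
  obtain ⟨δ, hδ⟩ := ZU.exists_loop hq.cont hq.shift hℓ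
  obtain ⟨a, ac, aadd, aL, hne⟩ := ZU.detect W hℓ0
  have h0Z : (0 : ℂ) ∈ ZU.Zt (latticeSubgroup W) (ZU.FF W ω) := Or.inl (latticeSubgroup W).zero_mem
  refine ⟨γ, δ, ZU.loop_inj hp hℓ hγ, ZU.loop_inj hq hℓ hδ, ?_, ?_,
    ZU.loops_homotopic hp.cont hq.cont hp.shift hq.shift hℓ hγ hδ,
    ZU.not_null hp.cont hp.shift ac aadd aL hne hγ⟩
  · rw [ZU.loop_range hp hγ, ZU.loop_range hq hδ, Set.eq_empty_iff_forall_notMem]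
    rintro x ⟨⟨y, hy, rfl⟩, ⟨z, hz, hzy⟩⟩
    rw [QuotientAddGroup.eq] at hzy
    refine hw0 _ hzy (ZU.cz_translate C hzy hwZ h0Z hz ?_)
    rw [add_neg_cancel_left]; exact hy
  · have hset : {k : ℂ | k ∉ W.lattice ∧ W.uFun ω k = 0} =
        {k | k ∉ latticeSubgroup W ∧ (ZU.FF W ω k).re = 0} := by
      ext k
      simp only [Set.mem_ofPred_eq, hL]
      rfl
    rw [hset, ZU.closure_eq C hp hℓ, ZU.loop_range hp hγ, ZU.loop_range hq hδ, ← Set.image_union]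
    apply Set.Subset.antisymm
    · rintro _ ⟨z, hz, rfl⟩
      obtain ⟨l, hl, h⟩ := hcov z hz
      refine ⟨z + l, h, ?_⟩
      exact QuotientAddGroup.mk_add_of_mem _ hl
    · apply Set.image_mono
      rintro z (hz | hz)
      · exact connectedComponentIn_subset _ _ hz
      · exact connectedComponentIn_subset _ _ hz
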